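/- arXiv:2503.05104 — 9 statements merged into one kernel-verified Lean document; each statement's English description precedes it below -/
import Mathlib

section
/- Let 0 < α < 1 and T > 0. For every continuously differentiable function v : [0,T] → ℝ and every t ∈ (0,T], one has v(t) · (D^α v)(t) ≥ (1/2) · (D^α (v²))(t), where D^α denotes the Caputo fractional derivative of order α. -/
open MeasureTheory Set

/-- The Caputo fractional derivative of order `α` of a function whose
derivative (on the relevant interval) is `u'`. -/
noncomputable def caputoD (α : ℝ) (u' : ℝ → ℝ) (t : ℝ) : ℝ :=
  (1 / Real.Gamma (1 - α)) * ∫ s in (0:ℝ)..t, u' s * (t - s) ^ (-α)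

/-- The kernel of the Caputo derivative, multiplied by a continuous function, is integrable. -/
theorem intervalIntegrable_mul_sub_rpow_neg {α t : ℝ} (hα1 : α < 1) (ht : 0 ≤ t) {f : ℝ → ℝ}
    (hf : ContinuousOn f (Icc 0 t)) :
    IntervalIntegrable (fun s => f s * (t - s) ^ (-α)) volume 0 t := by
  have h : IntervalIntegrable (fun x : ℝ => x ^ (-α)) volume t 0 :=
    intervalIntegral.intervalIntegrable_rpow' (by linarith)
  have h' := h.comp_sub_left t
  rw [sub_self, sub_zero] at h'
  exact h'.continuousOn_mul (by rwa [uIcc_of_le ht])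

/-- A square vanishing to second order at `t` stays continuous at `t` after division by
`(t - s) ^ α` with `α < 1`. -/
theorem continuousOn_sq_sub_mul_rpow_neg {α t : ℝ} (hα1 : α < 1) {v v' : ℝ → ℝ}
    (ht : 0 < t) (hderiv : ∀ s ∈ Icc (0:ℝ) t, HasDerivWithinAt v (v' s) (Icc 0 t) s) :
    ContinuousOn (fun s => (v t - v s) ^ 2 * (t - s) ^ (-α)) (Icc 0 t) := by
  intro s hs
  rcases hs.2.lt_or_eq with hst | rfl
  · have hv := (hderiv s hs).continuousWithinAt
    have hk : ContinuousWithinAt (fun x => (t - x) ^ (-α)) (Icc 0 t) s :=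
      ((continuousWithinAt_const.sub continuousWithinAt_id).rpow_const
        (Or.inl (sub_pos.2 hst).ne'))
    exact ((continuousWithinAt_const.sub hv).pow 2).mul hk
  · have hO := (hderiv s hs).isBigO_sub
    obtain ⟨C, hC⟩ := hO.bound
    rw [Filter.prod_pure, Filter.eventually_map] at hC
    have hz : Filter.Tendsto (fun x => C ^ 2 * (s - x) ^ (2 - α))
        (nhdsWithin s (Icc 0 s)) (nhds 0) := by
      have hc : Continuous fun x : ℝ => C ^ 2 * (s - x) ^ (2 - α) :=
        continuous_const.mul ((continuous_const.sub continuous_id).rpow_const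
          fun _ => Or.inr (by linarith))
      have h0 := (hc.tendsto s).mono_left (nhdsWithin_le_nhds (s := Icc 0 s))
      simpa [Real.zero_rpow (show 2 - α ≠ 0 by linarith)] using h0
    have hlim : (v s - v s) ^ 2 * (s - s) ^ (-α) = 0 := by simp
    unfold ContinuousWithinAt
    beta_reduce
    rw [hlim]
    refine squeeze_zero' ?_ ?_ hz
    · filter_upwards [self_mem_nhdsWithin] with x hx
      exact mul_nonneg (sq_nonneg _) (Real.rpow_nonneg (sub_nonneg.2 hx.2) _)
    · filter_upwards [self_mem_nhdsWithin, hC] with x hx hCx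
      rcases hx.2.lt_or_eq with hxs | rfl
      · have hp : 0 < s - x := sub_pos.2 hxs
        have hsq : (v s - v x) ^ 2 ≤ C ^ 2 * (s - x) ^ 2 := by
          rw [← mul_pow, ← sq_abs (v s - v x), abs_sub_comm]
          refine pow_le_pow_left₀ (abs_nonneg _) ?_ 2
          simpa [Real.norm_eq_abs, abs_sub_comm x s, abs_of_pos hp] using hCx
        calc (v s - v x) ^ 2 * (s - x) ^ (-α)
            ≤ C ^ 2 * (s - x) ^ 2 * (s - x) ^ (-α) :=
              mul_le_mul_of_nonneg_right hsq (Real.rpow_nonneg hp.le _)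
          _ = C ^ 2 * (s - x) ^ (2 - α) := by
              rw [mul_assoc, sub_eq_add_neg 2 α, Real.rpow_add hp, Real.rpow_two]
      · simp [Real.zero_rpow (show 2 - α ≠ 0 by linarith)]

/-- The weighted integral of `(v t - v s) * v' s` against the Caputo kernel is nonnegative. -/
theorem integral_sub_mul_deriv_mul_rpow_neg_nonneg {α t : ℝ} (hα : 0 < α) (hα1 : α < 1)
    (ht : 0 < t) {v v' : ℝ → ℝ}
    (hderiv : ∀ s ∈ Icc (0:ℝ) t, HasDerivWithinAt v (v' s) (Icc 0 t) s)
    (hcont : ContinuousOn v' (Icc 0 t)) :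
    0 ≤ ∫ s in (0:ℝ)..t, (v t - v s) * v' s * (t - s) ^ (-α) := by
  have hv : ContinuousOn v (Icc 0 t) := fun s hs => (hderiv s hs).continuousWithinAt
  have hφ : IntegrableOn (fun s => -2 * ((v t - v s) * v' s) * (t - s) ^ (-α)) (Icc 0 t) :=
    (intervalIntegrable_iff_integrableOn_Icc_of_le ht.le).1
      (intervalIntegrable_mul_sub_rpow_neg hα1 ht.le
        (continuousOn_const.mul ((continuousOn_const.sub hv).mul hcont)))
  have key := intervalIntegral.integral_le_sub_of_hasDeriv_right_of_le ht.le
    (continuousOn_sq_sub_mul_rpow_neg hα1 ht hderiv)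
    (g' := fun s => -2 * ((v t - v s) * v' s) * (t - s) ^ (-α)
      + (v t - v s) ^ 2 * (α * (t - s) ^ (-α - 1))) ?_ hφ ?_
  · have h0 : 0 ≤ (v t - v 0) ^ 2 * (t - 0) ^ (-α) :=
      mul_nonneg (sq_nonneg _) (Real.rpow_nonneg (by linarith) _)
    simp only [mul_assoc (-2 : ℝ), intervalIntegral.integral_const_mul, sub_self] at key
    norm_num at key h0
    linarith
  · intro s hs
    have hd : HasDerivAt v (v' s) s :=
      (hderiv s (Ioo_subset_Icc_self hs)).hasDerivAt (Icc_mem_nhds hs.1 hs.2)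
    have hk := ((hasDerivAt_id s).const_sub t).rpow_const (p := -α)
      (Or.inl (sub_pos.2 hs.2).ne')
    refine (((hd.const_sub (v t)).pow 2).mul hk).hasDerivWithinAt.congr_deriv ?_
    simp only [id, Nat.cast_ofNat, Nat.add_one_sub_one, Pi.pow_apply]
    ring
  · intro s hs
    have := mul_nonneg (sq_nonneg (v t - v s))
      (mul_nonneg hα.le (Real.rpow_nonneg (sub_pos.2 hs.2).le (-α - 1)))
    linarith

/-- For `0 < α < 1` and a continuously differentiable `v : [0,T] → ℝ`,
`v(t) · (D^α v)(t) ≥ (1/2) · (D^α v²)(t)` for `t ∈ (0,T]`. -/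
theorem caputo_product_inequality
    (α T : ℝ) (hα : 0 < α) (hα1 : α < 1) (hT : 0 < T)
    (v v' : ℝ → ℝ)
    (hderiv : ∀ s ∈ Icc (0:ℝ) T, HasDerivWithinAt v (v' s) (Icc 0 T) s)
    (hcont : ContinuousOn v' (Icc 0 T))
    (t : ℝ) (ht : t ∈ Ioc (0:ℝ) T) :
    v t * caputoD α v' t ≥ (1/2) * caputoD α (fun s => 2 * v s * v' s) t := by
  have hsub : Icc 0 t ⊆ Icc 0 T := Icc_subset_Icc_right ht.2
  have hderiv' : ∀ s ∈ Icc (0:ℝ) t, HasDerivWithinAt v (v' s) (Icc 0 t) s :=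
    fun s hs => (hderiv s (hsub hs)).mono hsub
  have hcont' := hcont.mono hsub
  have hv : ContinuousOn v (Icc 0 t) := fun s hs => (hderiv' s hs).continuousWithinAt
  have hnonneg := integral_sub_mul_deriv_mul_rpow_neg_nonneg hα hα1 ht.1 hderiv' hcont'
  have hi₁ := (intervalIntegrable_mul_sub_rpow_neg hα1 ht.1.le hcont').const_mul (v t)
  have hi₂ := intervalIntegrable_mul_sub_rpow_neg hα1 ht.1.le (hv.mul hcont')
  have hsplit : ∫ s in (0:ℝ)..t, (v t - v s) * v' s * (t - s) ^ (-α)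
      = v t * (∫ s in (0:ℝ)..t, v' s * (t - s) ^ (-α))
        - ∫ s in (0:ℝ)..t, v s * v' s * (t - s) ^ (-α) := by
    rw [← intervalIntegral.integral_const_mul]
    refine Eq.trans ?_ (intervalIntegral.integral_sub hi₁ hi₂)
    congr 1
    ext s
    ring
  have hΓ : 0 ≤ 1 / Real.Gamma (1 - α) :=
    (one_div_pos.2 (Real.Gamma_pos_of_pos (by linarith))).le
  have hmul := mul_nonneg hΓ (hsplit ▸ hnonneg)
  simp only [caputoD, mul_assoc (2 : ℝ), intervalIntegral.integral_const_mul]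
  linarith
end

section
/- Let 0 < α < 1, T > 0, let w : [0,T] → ℝ be continuously differentiable with w(0) = 0, and let G : [0,T] → ℝ be continuous and nonnegative. If (D^α w)(t) ≤ G(t) for all t ∈ (0,T], then for every t ∈ [0,T] one has w(t) ≤ (1/Γ(α)) ∫₀ᵗ (t−s)^{α−1} G(s) ds. -/
open MeasureTheory Set

theorem integral_rpow_mul_rpow_eq_Gamma_mul_Gamma {α : ℝ} (hα : 0 < α) (hα1 : α < 1) {a b : ℝ}
    (hab : a < b) :
    ∫ s in a..b, (b - s) ^ (α - 1) * (s - a) ^ (-α) = Real.Gamma α * Real.Gamma (1 - α) := by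
  have hshift : ∫ s in a..b, (b - s) ^ (α - 1) * (s - a) ^ (-α) =
      ∫ x in (0:ℝ)..(b - a), x ^ (-α) * ((b - a) - x) ^ (α - 1) := by
    have h := intervalIntegral.integral_comp_sub_right (a := a) (b := b)
      (fun x : ℝ => x ^ (-α) * ((b - a) - x) ^ (α - 1)) a
    rw [sub_self] at h
    rw [← h]
    refine intervalIntegral.integral_congr fun s _ => ?_
    simp only [sub_sub_sub_cancel_right]
    ring
  have hbeta := Complex.betaIntegral_scaled ((1 - α : ℝ) : ℂ) (α : ℂ) (sub_pos.2 hab)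
  have hGamma := Complex.Gamma_mul_Gamma_eq_betaIntegral (s := ((1 - α : ℝ) : ℂ)) (t := (α : ℂ))
    (by simpa using hα1) (by simpa using hα)
  have hsum : ((1 - α : ℝ) : ℂ) + (α : ℂ) = 1 := by push_cast; ring
  rw [hsum, Complex.Gamma_one, one_mul] at hGamma
  rw [hsum, sub_self, Complex.cpow_zero, one_mul, ← hGamma] at hbeta
  rw [hshift]
  apply Complex.ofReal_injective
  rw [← intervalIntegral.integral_ofReal, Complex.ofReal_mul, ← Complex.Gamma_ofReal,
    ← Complex.Gamma_ofReal, mul_comm (Complex.Gamma _), ← hbeta]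
  refine intervalIntegral.integral_congr fun x hx => ?_
  rw [uIcc_of_le (sub_pos.2 hab).le] at hx
  have h1 : (0:ℝ) ≤ b - a - x := sub_nonneg.2 hx.2
  rw [Complex.ofReal_mul, Complex.ofReal_cpow hx.1, Complex.ofReal_cpow h1]
  push_cast
  congr 2
  ring

theorem intervalIntegrable_rpow_mul_rpow {α : ℝ} (hα : 0 < α) (hα1 : α < 1) {a b : ℝ}
    (hab : a < b) :
    IntervalIntegrable (fun s => (b - s) ^ (α - 1) * (s - a) ^ (-α)) volume a b := by
  by_contra h
  have h0 := integral_rpow_mul_rpow_eq_Gamma_mul_Gamma hα hα1 hab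
  rw [intervalIntegral.integral_undef h] at h0
  exact (mul_pos (Real.Gamma_pos_of_pos hα) (Real.Gamma_pos_of_pos (sub_pos.2 hα1))).ne h0

/-- The integrand of the iterated fractional integral, restricted to the triangle `r < s`. -/
noncomputable def abelKernel (α t : ℝ) (f : ℝ → ℝ) (p : ℝ × ℝ) : ℝ :=
  {q : ℝ × ℝ | q.2 < q.1}.indicator
    (fun q => (t - q.1) ^ (α - 1) * (f q.2 * (q.1 - q.2) ^ (-α))) p

theorem abelKernel_left (α t : ℝ) (f : ℝ → ℝ) (r : ℝ) :
    (fun s => abelKernel α t f (s, r)) =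
      (Ioi r).indicator (fun s => f r * ((t - s) ^ (α - 1) * (s - r) ^ (-α))) := by
  funext s
  by_cases h : r < s
  · simp only [abelKernel, indicator, mem_ofPred_eq, mem_Ioi, h, if_true]
    ring
  · simp [abelKernel, h]

theorem abelKernel_right (α t : ℝ) (f : ℝ → ℝ) (s : ℝ) :
    (fun r => abelKernel α t f (s, r)) =
      (Iio s).indicator (fun r => (t - s) ^ (α - 1) * (f r * (s - r) ^ (-α))) := by
  funext r
  by_cases h : r < s <;> simp [abelKernel, h]

theorem Ioi_inter_Ioc_of_nonneg {r t : ℝ} (hr : 0 ≤ r) : Ioi r ∩ Ioc 0 t = Ioc r t := by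
  ext s
  simp only [mem_inter_iff, mem_Ioi, mem_Ioc]
  constructor
  · rintro ⟨h, -, h'⟩
    exact ⟨h, h'⟩
  · rintro ⟨h, h'⟩
    exact ⟨h, hr.trans_lt h, h'⟩

theorem integrable_abelKernel_left {α : ℝ} (hα : 0 < α) (hα1 : α < 1) {r t : ℝ} (f : ℝ → ℝ)
    (hr : r ∈ Ioo 0 t) :
    Integrable (fun s => abelKernel α t f (s, r)) (volume.restrict (Ioc 0 t)) := by
  rw [abelKernel_left, integrable_indicator_iff measurableSet_Ioi, IntegrableOn,
    Measure.restrict_restrict measurableSet_Ioi, Ioi_inter_Ioc_of_nonneg hr.1.le]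
  exact ((intervalIntegrable_rpow_mul_rpow hα hα1 hr.2).const_mul (f r)).1

theorem integral_abelKernel_left {α : ℝ} (hα : 0 < α) (hα1 : α < 1) {r t : ℝ} (f : ℝ → ℝ)
    (hr : r ∈ Ioo 0 t) :
    ∫ s in Ioc 0 t, abelKernel α t f (s, r) = f r * (Real.Gamma α * Real.Gamma (1 - α)) := by
  rw [abelKernel_left, integral_indicator measurableSet_Ioi,
    Measure.restrict_restrict measurableSet_Ioi, Ioi_inter_Ioc_of_nonneg hr.1.le,
    integral_const_mul, ← intervalIntegral.integral_of_le hr.2.le,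
    integral_rpow_mul_rpow_eq_Gamma_mul_Gamma hα hα1 hr.2]

theorem integral_abelKernel_right (α : ℝ) {s t : ℝ} (f : ℝ → ℝ) (hs : s ∈ Ioc 0 t) :
    ∫ r in Ioc 0 t, abelKernel α t f (s, r) =
      (t - s) ^ (α - 1) * ∫ r in (0:ℝ)..s, f r * (s - r) ^ (-α) := by
  have hset : Iio s ∩ Ioc 0 t = Ioo 0 s := by
    ext r
    simp only [mem_inter_iff, mem_Iio, mem_Ioc, mem_Ioo]
    constructor
    · rintro ⟨h, h', -⟩
      exact ⟨h', h⟩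
    · rintro ⟨h, h'⟩
      exact ⟨h', h, h'.le.trans hs.2⟩
  rw [abelKernel_right, integral_indicator measurableSet_Iio,
    Measure.restrict_restrict measurableSet_Iio, hset, integral_const_mul,
    ← integral_Ioc_eq_integral_Ioo, ← intervalIntegral.integral_of_le hs.1.le]

theorem norm_abelKernel {α t s r : ℝ} (f : ℝ → ℝ) (hs : s ≤ t) :
    ‖abelKernel α t f (s, r)‖ = abelKernel α t (fun x => |f x|) (s, r) := by
  by_cases h : r < s
  · have h1 : 0 ≤ (t - s) ^ (α - 1) := Real.rpow_nonneg (sub_nonneg.2 hs) _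
    have h2 : 0 ≤ (s - r) ^ (-α) := Real.rpow_nonneg (sub_pos.2 h).le _
    simp [abelKernel, h, abs_of_nonneg h1, abs_of_nonneg h2]
  · simp [abelKernel, h]

theorem ae_mem_Ioo_restrict_Ioc (a b : ℝ) : ∀ᵐ x ∂volume.restrict (Ioc a b), x ∈ Ioo a b := by
  rw [← restrict_Ioo_eq_restrict_Ioc]
  exact ae_restrict_mem measurableSet_Ioo

theorem integrable_abelKernel {α : ℝ} (hα : 0 < α) (hα1 : α < 1) {t : ℝ} {f : ℝ → ℝ}
    (hf : ContinuousOn f (Icc 0 t)) :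
    Integrable (abelKernel α t f)
      ((volume.restrict (Ioc 0 t)).prod (volume.restrict (Ioc 0 t))) := by
  have hf' : IntegrableOn f (Ioc 0 t) :=
    (hf.integrableOn_compact isCompact_Icc).mono_set Ioc_subset_Icc_self
  have hmeas : AEStronglyMeasurable (abelKernel α t f)
      ((volume.restrict (Ioc 0 t)).prod (volume.restrict (Ioc 0 t))) := by
    refine AEStronglyMeasurable.indicator ?_ (measurableSet_lt measurable_snd measurable_fst)
    refine AEStronglyMeasurable.mul ?_ (AEStronglyMeasurable.mul ?_ ?_)
    · exact Measurable.aestronglyMeasurable (by fun_prop)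
    · exact hf'.aestronglyMeasurable.comp_snd
    · exact Measurable.aestronglyMeasurable (by fun_prop)
  refine (integrable_prod_iff' hmeas).2 ⟨?_, ?_⟩
  · filter_upwards [ae_mem_Ioo_restrict_Ioc 0 t] with r hr
    exact integrable_abelKernel_left hα hα1 f hr
  · refine (hf'.abs.mul_const (Real.Gamma α * Real.Gamma (1 - α))).congr ?_
    filter_upwards [ae_mem_Ioo_restrict_Ioc 0 t] with r hr
    rw [← integral_abelKernel_left hα hα1 (fun x => |f x|) hr]
    exact setIntegral_congr_fun measurableSet_Ioc fun s hs => (norm_abelKernel f hs.2).symm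

theorem intervalIntegrable_rpow_mul_integral_mul_rpow {α : ℝ} (hα : 0 < α) (hα1 : α < 1) {t : ℝ}
    (ht : 0 ≤ t) {f : ℝ → ℝ} (hf : ContinuousOn f (Icc 0 t)) :
    IntervalIntegrable (fun s => (t - s) ^ (α - 1) * ∫ r in (0:ℝ)..s, f r * (s - r) ^ (-α))
      volume 0 t := by
  rw [intervalIntegrable_iff_integrableOn_Ioc_of_le ht]
  refine (integrable_abelKernel hα hα1 hf).integral_prod_left.congr ?_
  filter_upwards [ae_restrict_mem measurableSet_Ioc] with s hs
  exact integral_abelKernel_right α f hs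

/-- The fractional integral of order `α` inverts the fractional integral of order `1 - α`
up to one integration (Abel's identity). -/
theorem integral_rpow_mul_integral_mul_rpow {α : ℝ} (hα : 0 < α) (hα1 : α < 1) {t : ℝ}
    (ht : 0 ≤ t) {f : ℝ → ℝ} (hf : ContinuousOn f (Icc 0 t)) :
    ∫ s in (0:ℝ)..t, (t - s) ^ (α - 1) * ∫ r in (0:ℝ)..s, f r * (s - r) ^ (-α) =
      Real.Gamma α * Real.Gamma (1 - α) * ∫ r in (0:ℝ)..t, f r := by
  rw [intervalIntegral.integral_of_le ht, intervalIntegral.integral_of_le ht, mul_comm,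
    ← integral_mul_const]
  calc
    _ = ∫ s in Ioc 0 t, ∫ r in Ioc 0 t, abelKernel α t f (s, r) :=
      setIntegral_congr_fun measurableSet_Ioc fun s hs => (integral_abelKernel_right α f hs).symm
    _ = ∫ r in Ioc 0 t, ∫ s in Ioc 0 t, abelKernel α t f (s, r) :=
      integral_integral_swap (f := fun s r => abelKernel α t f (s, r))
        (integrable_abelKernel hα hα1 hf)
    _ = _ := by
      refine integral_congr_ae ?_
      filter_upwards [ae_mem_Ioo_restrict_Ioc 0 t] with r hr
      exact integral_abelKernel_left hα hα1 f hr

theorem intervalIntegrable_sub_rpow_mul {α : ℝ} (hα : 0 < α) {t : ℝ} (ht : 0 ≤ t) {G : ℝ → ℝ}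
    (hG : ContinuousOn G (Icc 0 t)) :
    IntervalIntegrable (fun s => (t - s) ^ (α - 1) * G s) volume 0 t := by
  have h := (intervalIntegral.intervalIntegrable_rpow' (a := 0) (b := t)
    (r := α - 1) (by linarith)).comp_sub_left t
  simp only [sub_zero, sub_self] at h
  exact h.symm.mul_continuousOn (by rwa [uIcc_of_le ht])

/-- If `w` is continuously differentiable on `[0,T]` with `w(0) = 0`, `G` is
continuous and nonnegative, and `(D^α w)(t) ≤ G(t)` on `(0,T]`, then
`w(t) ≤ (1/Γ(α)) ∫₀ᵗ (t−s)^{α−1} G(s) ds` on `[0,T]`. -/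
theorem caputo_comparison
    (α T : ℝ) (hα : 0 < α) (hα1 : α < 1) (hT : 0 < T)
    (w w' G : ℝ → ℝ)
    (hderiv : ∀ s ∈ Icc (0:ℝ) T, HasDerivWithinAt w (w' s) (Icc 0 T) s)
    (hcont : ContinuousOn w' (Icc 0 T))
    (hw0 : w 0 = 0)
    (hG : ContinuousOn G (Icc 0 T))
    (hGpos : ∀ s ∈ Icc (0:ℝ) T, 0 ≤ G s)
    (hle : ∀ t ∈ Ioc (0:ℝ) T, caputoD α w' t ≤ G t)
    (t : ℝ) (ht : t ∈ Icc (0:ℝ) T) :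
    w t ≤ (1 / Real.Gamma α) * ∫ s in (0:ℝ)..t, (t - s) ^ (α - 1) * G s := by
  have hsub : Icc 0 t ⊆ Icc 0 T := Icc_subset_Icc_right ht.2
  have hcont' := hcont.mono hsub
  have hg := Real.Gamma_pos_of_pos hα
  have hg1 := Real.Gamma_pos_of_pos (sub_pos.2 hα1)
  have hftc : ∫ r in (0:ℝ)..t, w' r = w t := by
    rw [intervalIntegral.integral_eq_sub_of_hasDerivAt_of_le ht.1
      (fun s hs => ((hderiv s (hsub hs)).mono hsub).continuousWithinAt)
      (fun s hs => (hderiv s (hsub (Ioo_subset_Icc_self hs))).hasDerivAt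
        (Icc_mem_nhds hs.1 (hs.2.trans_le ht.2)))
      (hcont'.intervalIntegrable_of_Icc ht.1), hw0, sub_zero]
  have hmono : ∫ s in (0:ℝ)..t, (t - s) ^ (α - 1) * ∫ r in (0:ℝ)..s, w' r * (s - r) ^ (-α) ≤
      ∫ s in (0:ℝ)..t, Real.Gamma (1 - α) * ((t - s) ^ (α - 1) * G s) := by
    refine intervalIntegral.integral_mono_on_of_le_Ioo ht.1
      (intervalIntegrable_rpow_mul_integral_mul_rpow hα hα1 ht.1 hcont')
      ((intervalIntegrable_sub_rpow_mul hα ht.1 (hG.mono hsub)).const_mul _) fun s hs => ?_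
    have h := hle s ⟨hs.1, hs.2.le.trans ht.2⟩
    rw [caputoD, one_div, inv_mul_le_iff₀ hg1] at h
    calc
      _ ≤ (t - s) ^ (α - 1) * (Real.Gamma (1 - α) * G s) :=
        mul_le_mul_of_nonneg_left h (Real.rpow_nonneg (sub_pos.2 hs.2).le _)
      _ = _ := by ring
  rw [integral_rpow_mul_integral_mul_rpow hα hα1 ht.1 hcont', hftc,
    intervalIntegral.integral_const_mul, mul_comm (Real.Gamma α), mul_assoc] at hmono
  rw [one_div, le_inv_mul_iff₀ hg]
  exact le_of_mul_le_mul_left hmono hg1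
end

section
/- (Discrete fractional Gronwall inequality.) Let 0 < α < 1, τ > 0, M ≥ 0, N ∈ ℕ, and set t_n = nτ. Let (a_n)_{0 ≤ n ≤ N} and (b_n)_{0 ≤ n ≤ N} be nonnegative real sequences with (b_n) nondecreasing, such that a_0 ≤ b_0 and, for every 1 ≤ n ≤ N, a_n ≤ b_n + M τ^α Σ_{j=0}^{n−1} (n−j)^{α−1} a_j. Then for every 0 ≤ n ≤ N one has a_n ≤ b_n · E_α(M Γ(α) t_n^α), where E_α(z) = Σ_{k=0}^∞ z^k / Γ(αk+1) is the Mittag-Leffler function. -/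
open MeasureTheory Set

/-- The (real) Mittag-Leffler function `E_{α,β}(x) = Σ_{k} x^k / Γ(αk+β)`. -/
noncomputable def mlE (α β x : ℝ) : ℝ :=
  ∑' k : ℕ, x ^ k / Real.Gamma (α * k + β)

theorem rpow_mul_exp_neg_le_Gamma_add_one {s A : ℝ} (hs : 0 ≤ s) (hA : 0 ≤ A) :
    A ^ s * Real.exp (-A) ≤ Real.Gamma (s + 1) := by
  have hint : IntegrableOn (fun x : ℝ => Real.exp (-x) * x ^ (s + 1 - 1)) (Ioi 0) :=
    Real.GammaIntegral_convergent (by linarith)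
  rw [Real.Gamma_eq_integral (by linarith), ← integral_exp_neg_Ioi A, ← integral_const_mul]
  calc ∫ x in Ioi A, A ^ s * Real.exp (-x)
      ≤ ∫ x in Ioi A, Real.exp (-x) * x ^ (s + 1 - 1) := by
        refine setIntegral_mono_on ((integrableOn_exp_neg_Ioi A).const_mul _)
          (hint.mono_set (Ioi_subset_Ioi hA)) measurableSet_Ioi fun x hx => ?_
        rw [add_sub_cancel_right, mul_comm]
        gcongr
        exact hx.le
    _ ≤ ∫ x in Ioi 0, Real.exp (-x) * x ^ (s + 1 - 1) := by
        refine setIntegral_mono_set hint ?_ (Ioi_subset_Ioi hA).eventuallyLE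
        filter_upwards [ae_restrict_mem measurableSet_Ioi] with x hx
        have : (0 : ℝ) < x := hx
        simp only [Pi.zero_apply]
        positivity

theorem summable_mlE_one {α x : ℝ} (hα : 0 < α) (hx : 0 ≤ x) :
    Summable fun k : ℕ => x ^ k / Real.Gamma (α * k + 1) := by
  set A : ℝ := (2 * (x + 1)) ^ α⁻¹
  have hA : 0 < A := by positivity
  have hAα : A ^ α = 2 * (x + 1) := Real.rpow_inv_rpow (by positivity) hα.ne'
  have hgeom : Summable fun k : ℕ => Real.exp A * (x / (2 * (x + 1))) ^ k := by
    refine (summable_geometric_of_lt_one (by positivity) ?_).mul_left _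
    rw [div_lt_one (by positivity)]
    linarith
  refine hgeom.of_nonneg_of_le (fun k => ?_) fun k => ?_
  · have := Real.Gamma_pos_of_pos (show 0 < α * k + 1 by positivity)
    positivity
  · have h := rpow_mul_exp_neg_le_Gamma_add_one (s := α * k) (by positivity) hA.le
    rw [Real.rpow_mul hA.le, hAα, Real.rpow_natCast] at h
    calc x ^ k / Real.Gamma (α * k + 1)
        ≤ x ^ k / ((2 * (x + 1)) ^ k * Real.exp (-A)) := by gcongr
      _ = Real.exp A * (x / (2 * (x + 1))) ^ k := by
        rw [Real.exp_neg, div_pow]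
        field_simp

theorem intervalIntegrable_sub_rpow_mul_rpow {α p : ℝ} (hα : 0 < α) (hp : 0 ≤ p) (c u v : ℝ) :
    IntervalIntegrable (fun x : ℝ => (c - x) ^ (α - 1) * x ^ p) volume u v := by
  have h : IntervalIntegrable (fun x : ℝ => (c - x) ^ (α - 1)) volume u v := by
    simpa using (intervalIntegral.intervalIntegrable_rpow' (a := c - u) (b := c - v)
      (show -1 < α - 1 by linarith)).comp_sub_left c
  exact h.mul_continuousOn (continuousOn_id.rpow_const fun _ _ => Or.inr hp)

theorem integral_sub_rpow_mul_rpow {α p c : ℝ} (hα : 0 < α) (hp : 0 ≤ p) (hc : 0 < c) :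
    ∫ x in (0 : ℝ)..c, (c - x) ^ (α - 1) * x ^ p =
      c ^ (p + α) * (Real.Gamma (p + 1) * Real.Gamma α / Real.Gamma (p + α + 1)) := by
  have hbeta := Complex.betaIntegral_eq_Gamma_mul_div ((p + 1 : ℝ) : ℂ) (α : ℂ)
    (by simpa using (by linarith : 0 < p + 1)) (by simpa using hα)
  have h := Complex.betaIntegral_scaled ((p + 1 : ℝ) : ℂ) (α : ℂ) hc
  rw [hbeta, ← Complex.ofReal_add, Complex.Gamma_ofReal, Complex.Gamma_ofReal,
    Complex.Gamma_ofReal] at h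
  apply Complex.ofReal_injective
  rw [← intervalIntegral.integral_ofReal]
  have hexp : p + 1 + α = p + α + 1 := by ring
  have hpow : (c : ℂ) ^ (((p + 1 + α : ℝ) : ℂ) - 1) = ((c ^ (p + α) : ℝ) : ℂ) := by
    rw [Complex.ofReal_cpow hc.le]
    push_cast
    ring_nf
  rw [hpow, hexp] at h
  push_cast at h ⊢
  rw [← h]
  refine intervalIntegral.integral_congr fun x hx => ?_
  rw [uIcc_of_le hc.le] at hx
  rw [Complex.ofReal_cpow (sub_nonneg.2 hx.2), Complex.ofReal_cpow hx.1, mul_comm]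
  push_cast
  ring_nf

theorem sum_sub_rpow_mul_rpow_le {α p : ℝ} (hα : 0 < α) (hα1 : α ≤ 1) (hp : 0 ≤ p) {n : ℕ}
    (hn : 0 < n) :
    ∑ j ∈ Finset.range n, ((n : ℝ) - j) ^ (α - 1) * (j : ℝ) ^ p ≤
      (n : ℝ) ^ (p + α) * (Real.Gamma (p + 1) * Real.Gamma α / Real.Gamma (p + α + 1)) := by
  rw [← integral_sub_rpow_mul_rpow hα hp (Nat.cast_pos.2 hn), ← Nat.cast_zero (R := ℝ),
    ← intervalIntegral.sum_integral_adjacent_intervals (a := fun k : ℕ => (k : ℝ))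
      fun _ _ => intervalIntegrable_sub_rpow_mul_rpow hα hp _ _ _]
  refine Finset.sum_le_sum fun j hj => ?_
  have hjn : (j : ℝ) + 1 ≤ n := by exact_mod_cast Finset.mem_range.1 hj
  calc ((n : ℝ) - j) ^ (α - 1) * (j : ℝ) ^ p
      = ∫ _ in (j : ℝ)..((j + 1 : ℕ) : ℝ), ((n : ℝ) - j) ^ (α - 1) * (j : ℝ) ^ p := by simp
    _ ≤ ∫ x in (j : ℝ)..((j + 1 : ℕ) : ℝ), ((n : ℝ) - x) ^ (α - 1) * x ^ p := by
      refine intervalIntegral.integral_mono_on_of_le_Ioo (by simp) (by simp)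
        (intervalIntegrable_sub_rpow_mul_rpow hα hp _ _ _) fun x hx => ?_
      have hx2 : x < (j : ℝ) + 1 := by simpa using hx.2
      have hx1 : (j : ℝ) < x := hx.1
      gcongr ?_ * ?_
      · exact Real.rpow_nonneg (by linarith) _
      · exact Real.rpow_le_rpow_of_nonpos (by linarith) (by linarith) (by linarith)
      · exact Real.rpow_le_rpow (by positivity) hx1.le hp

theorem one_add_sum_mul_mlE_le {α L : ℝ} (hα : 0 < α) (hα1 : α ≤ 1) (hL : 0 ≤ L) {n : ℕ}
    (hn : 0 < n) :
    1 + L * ∑ j ∈ Finset.range n,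
        ((n : ℝ) - j) ^ (α - 1) * mlE α 1 (L * Real.Gamma α * (j : ℝ) ^ α) ≤
      mlE α 1 (L * Real.Gamma α * (n : ℝ) ^ α) := by
  have hΓ : 0 < Real.Gamma α := Real.Gamma_pos_of_pos hα
  have hsum (j : ℕ) := summable_mlE_one hα (x := L * Real.Gamma α * (j : ℝ) ^ α) (by positivity)
  have hsum' (j : ℕ) := (hsum j).mul_left (((n : ℝ) - j) ^ (α - 1))
  have hsumn := (summable_nat_add_iff 1).2 (hsum n)
  simp only [mlE]
  rw [(hsum n).tsum_eq_zero_add]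
  simp only [← tsum_mul_left]
  rw [← Summable.tsum_finsetSum fun j _ => hsum' j, ← tsum_mul_left]
  simp only [pow_zero, Nat.cast_zero, mul_zero, zero_add, Real.Gamma_one, div_one]
  refine add_le_add_right ?_ 1
  refine Summable.tsum_le_tsum (fun k => ?_)
    ((summable_sum fun j _ => hsum' j).mul_left L) hsumn
  have hG : 0 < Real.Gamma (α * k + 1) := Real.Gamma_pos_of_pos (by positivity)
  have hpow (j : ℕ) (m : ℕ) : ((j : ℝ) ^ α) ^ m = (j : ℝ) ^ (α * m) := by
    rw [Real.rpow_mul (by positivity), Real.rpow_natCast]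
  calc L * ∑ j ∈ Finset.range n, ((n : ℝ) - j) ^ (α - 1) *
          ((L * Real.Gamma α * (j : ℝ) ^ α) ^ k / Real.Gamma (α * k + 1))
      = L * (L * Real.Gamma α) ^ k / Real.Gamma (α * k + 1) *
          ∑ j ∈ Finset.range n, ((n : ℝ) - j) ^ (α - 1) * (j : ℝ) ^ (α * k) := by
        rw [Finset.mul_sum, Finset.mul_sum]
        refine Finset.sum_congr rfl fun j _ => ?_
        rw [mul_pow (L * Real.Gamma α), hpow]
        ring
    _ ≤ L * (L * Real.Gamma α) ^ k / Real.Gamma (α * k + 1) * ((n : ℝ) ^ (α * k + α) *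
          (Real.Gamma (α * k + 1) * Real.Gamma α / Real.Gamma (α * k + α + 1))) := by
        gcongr
        exact sum_sub_rpow_mul_rpow_le hα hα1 (by positivity) hn
    _ = (L * Real.Gamma α * (n : ℝ) ^ α) ^ (k + 1) / Real.Gamma (α * (k + 1 : ℕ) + 1) := by
        rw [mul_pow (L * Real.Gamma α), hpow]
        push_cast
        rw [mul_add, mul_one, pow_succ']
        field_simp

/-- Discrete fractional Gronwall inequality: if `a_n ≤ b_n + M τ^α
Σ_{j<n} (n−j)^{α−1} a_j` with `a, b ≥ 0`, `b` nondecreasing, `a_0 ≤ b_0`,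
then `a_n ≤ b_n E_α(M Γ(α) t_n^α)` where `t_n = nτ`. -/
theorem discrete_fractional_gronwall
    (α τ M : ℝ) (hα : 0 < α) (hα1 : α < 1) (hτ : 0 < τ) (hM : 0 ≤ M)
    (N : ℕ) (a b : ℕ → ℝ)
    (ha : ∀ n ≤ N, 0 ≤ a n) (hb : ∀ n ≤ N, 0 ≤ b n)
    (hbmono : ∀ m n : ℕ, m ≤ n → n ≤ N → b m ≤ b n)
    (h0 : a 0 ≤ b 0)
    (hrec : ∀ n : ℕ, 1 ≤ n → n ≤ N →
      a n ≤ b n + M * τ ^ α * ∑ j ∈ Finset.range n, ((n : ℝ) - j) ^ (α - 1) * a j) :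
    ∀ n ≤ N, a n ≤ b n * mlE α 1 (M * Real.Gamma α * ((n : ℝ) * τ) ^ α) := by
  have hscale (n : ℕ) : M * Real.Gamma α * ((n : ℝ) * τ) ^ α =
      M * τ ^ α * Real.Gamma α * (n : ℝ) ^ α := by
    rw [Real.mul_rpow (by positivity) hτ.le]
    ring
  intro n
  induction n using Nat.strong_induction_on with
  | _ n ih =>
  intro hn
  rw [hscale]
  rcases Nat.eq_zero_or_pos n with rfl | hpos
  · have hE : mlE α 1 0 = 1 := by
      rw [mlE, tsum_eq_single 0 fun k hk => by simp [hk]]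
      simp
    simpa [Real.zero_rpow hα.ne', hE] using h0
  · calc a n ≤ b n + M * τ ^ α * ∑ j ∈ Finset.range n, ((n : ℝ) - j) ^ (α - 1) * a j :=
          hrec n hpos hn
      _ ≤ b n + M * τ ^ α * ∑ j ∈ Finset.range n, ((n : ℝ) - j) ^ (α - 1) *
            (b n * mlE α 1 (M * τ ^ α * Real.Gamma α * (j : ℝ) ^ α)) := by
          gcongr with j hj
          · have hjn : (j : ℝ) < n := by exact_mod_cast Finset.mem_range.1 hj
            exact Real.rpow_nonneg (by linarith) _
          · have hj := Finset.mem_range.1 hj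
            have h := ih j hj (by omega)
            rw [hscale] at h
            refine h.trans (mul_le_mul_of_nonneg_right (hbmono j n hj.le hn) ?_)
            refine tsum_nonneg fun k => div_nonneg (pow_nonneg ?_ k)
              (Real.Gamma_pos_of_pos (by positivity)).le
            have := Real.Gamma_pos_of_pos hα
            positivity
      _ = b n * (1 + M * τ ^ α * ∑ j ∈ Finset.range n, ((n : ℝ) - j) ^ (α - 1) *
            mlE α 1 (M * τ ^ α * Real.Gamma α * (j : ℝ) ^ α)) := by
          simp only [mul_left_comm _ (b n), ← Finset.mul_sum]
          ring
      _ ≤ b n * mlE α 1 (M * τ ^ α * Real.Gamma α * (n : ℝ) ^ α) :=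
          mul_le_mul_of_nonneg_left
            (one_add_sum_mul_mlE_le hα hα1.le (by positivity) hpos) (hb n hn)
end

section
/- Let 0 < α < 1, β > 0, λ ≥ 0, and let s > 0 be a real number with s^α > λ. Then ∫₀^∞ e^{−st} t^{β−1} E_{α,β}(−λ t^α) dt = s^{α−β} / (s^α + λ); that is, t ↦ t^{β−1} E_{α,β}(−λ t^α) is the inverse Laplace transform of s ↦ s^{α−β}/(s^α + λ). -/
open MeasureTheory Set

/-- The power `t ^ (a - 1)` has a convergent Laplace integral for `a > 0`. -/
theorem integrableOn_rpow_mul_exp_neg_mul_Ioi {a s : ℝ} (ha : 0 < a) (hs : 0 < s) :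
    IntegrableOn (fun t : ℝ => t ^ (a - 1) * Real.exp (-(s * t))) (Ioi 0) := by
  refine not_imp_comm.1 integral_undef ?_
  rw [Real.integral_rpow_mul_exp_neg_mul_Ioi ha hs]
  have := Real.Gamma_pos_of_pos ha
  positivity

/-- The terms of the Mittag-Leffler integrand, with the powers of `t` collected. -/
theorem exp_mul_rpow_mul_mittagLeffler_term (α β lam s : ℝ) (k : ℕ) {t : ℝ} (ht : 0 < t) :
    Real.exp (-(s * t)) * (t ^ (β - 1) * ((-lam * t ^ α) ^ k / Real.Gamma (α * k + β))) =
      (-lam) ^ k / Real.Gamma (α * k + β) *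
        (t ^ (α * k + β - 1) * Real.exp (-(s * t))) := by
  rw [add_sub_assoc, Real.rpow_add ht, Real.rpow_mul ht.le, Real.rpow_natCast, mul_pow]
  ring

/-- The Laplace transform of `t ^ (α * k + β - 1) / Γ(α * k + β)`, as a geometric term. -/
theorem div_Gamma_mul_integral_rpow_mul_exp_neg_mul {α β s : ℝ} (c : ℝ) (k : ℕ)
    (hα : 0 ≤ α) (hβ : 0 < β) (hs : 0 < s) :
    c ^ k / Real.Gamma (α * k + β) *
        ∫ t in Ioi (0 : ℝ), t ^ (α * k + β - 1) * Real.exp (-(s * t)) =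
      s ^ (-β) * (c / s ^ α) ^ k := by
  have ha : 0 < α * k + β := by positivity
  have hΓ := (Real.Gamma_pos_of_pos ha).ne'
  have hsα := (Real.rpow_pos_of_pos hs α).ne'
  rw [Real.integral_rpow_mul_exp_neg_mul_Ioi ha hs, one_div, Real.inv_rpow hs.le,
    Real.rpow_add hs, Real.rpow_mul hs.le, Real.rpow_natCast, Real.rpow_neg hs.le, div_pow]
  field_simp

/-- Laplace transform identity: for `0 < α < 1`, `β > 0`, `λ ≥ 0`, `s > 0` with
`s^α > λ`, `∫₀^∞ e^{−st} t^{β−1} E_{α,β}(−λ t^α) dt = s^{α−β}/(s^α + λ)`. -/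
theorem laplace_mittagLeffler
    (α β lam s : ℝ) (hα : 0 < α) (hα1 : α < 1) (hβ : 0 < β) (hlam : 0 ≤ lam)
    (hs : 0 < s) (hsα : lam < s ^ α) :
    ∫ t in Ioi (0:ℝ), Real.exp (-(s * t)) * (t ^ (β - 1) * mlE α β (-lam * t ^ α))
      = s ^ (α - β) / (s ^ α + lam) := by
  have hsα0 : 0 < s ^ α := Real.rpow_pos_of_pos hs α
  have hpos (k : ℕ) : 0 < α * k + β := by positivity
  let F (k : ℕ) (t : ℝ) : ℝ := (-lam) ^ k / Real.Gamma (α * k + β) *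
    (t ^ (α * k + β - 1) * Real.exp (-(s * t)))
  have hF_int (k : ℕ) : Integrable (F k) (volume.restrict (Ioi 0)) :=
    (integrableOn_rpow_mul_exp_neg_mul_Ioi (hpos k) hs).const_mul _
  have hF_norm (k : ℕ) : ∫ t in Ioi (0 : ℝ), ‖F k t‖ = s ^ (-β) * (lam / s ^ α) ^ k := by
    rw [← div_Gamma_mul_integral_rpow_mul_exp_neg_mul lam k hα.le hβ hs, ← integral_const_mul]
    refine setIntegral_congr_fun measurableSet_Ioi fun t (ht : 0 < t) => ?_
    have h : 0 ≤ t ^ (α * k + β - 1) * Real.exp (-(s * t)) := by positivity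
    change ‖F k t‖ = _
    rw [norm_mul, Real.norm_of_nonneg h, norm_div, norm_pow, norm_neg, Real.norm_of_nonneg hlam,
      Real.norm_of_nonneg (Real.Gamma_pos_of_pos (hpos k)).le]
  have hF_sum : Summable fun k => ∫ t in Ioi (0 : ℝ), ‖F k t‖ := by
    simp only [hF_norm]
    exact (summable_geometric_of_lt_one (by positivity) ((div_lt_one hsα0).2 hsα)).mul_left _
  calc
    _ = ∫ t in Ioi (0 : ℝ), ∑' k, F k t := by
      refine setIntegral_congr_fun measurableSet_Ioi fun t (ht : 0 < t) => ?_
      simp only [mlE, ← tsum_mul_left, exp_mul_rpow_mul_mittagLeffler_term α β lam s _ ht, F]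
    _ = ∑' k, ∫ t in Ioi (0 : ℝ), F k t :=
      (integral_tsum_of_summable_integral_norm hF_int hF_sum).symm
    _ = ∑' k : ℕ, s ^ (-β) * (-lam / s ^ α) ^ k := by
      simp only [F, integral_const_mul,
        div_Gamma_mul_integral_rpow_mul_exp_neg_mul _ _ hα.le hβ hs]
    _ = s ^ (α - β) / (s ^ α + lam) := by
      have habs : |(-lam) / s ^ α| < 1 := by
        rw [abs_div, abs_neg, abs_of_nonneg hlam, abs_of_pos hsα0]
        exact (div_lt_one hsα0).2 hsα
      rw [tsum_mul_left, tsum_geometric_of_abs_lt_one habs, sub_eq_add_neg α β,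
        Real.rpow_add hs]
      have : s ^ α + lam ≠ 0 := by positivity
      have : 1 - -lam / s ^ α = (s ^ α + lam) / s ^ α := by field_simp; ring
      rw [this, inv_div]
      ring
end

section
/- Let α > 0, β > 0 and λ ∈ ℝ. For every t > 0, the function t ↦ t^β E_{α,β+1}(−λ t^α) is differentiable and d/dt [ t^β E_{α,β+1}(−λ t^α) ] = t^{β−1} E_{α,β}(−λ t^α). -/
/-- The Gamma function eventually dominates every exponential `C ^ s`. -/
theorem rpow_le_mul_Gamma {C s : ℝ} (hC : 1 ≤ C) (hs : 2 ≤ s) :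
    C ^ s ≤ C ^ 2 * Real.exp C * Real.Gamma s := by
  obtain ⟨n, hn⟩ : ∃ n, ⌊s⌋₊ = n + 2 :=
    Nat.exists_eq_add_of_le' (Nat.le_floor (by exact_mod_cast hs))
  have hlo : ((n + 2 : ℕ) : ℝ) ≤ s := hn ▸ Nat.floor_le (by linarith)
  have hhi : s ≤ ((n + 3 : ℕ) : ℝ) := by
    have := Nat.lt_floor_add_one s
    rw [hn] at this
    push_cast at this ⊢
    linarith
  have hfact : ((n + 1).factorial : ℝ) ≤ Real.Gamma s := by
    rw [← Real.Gamma_nat_eq_factorial]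
    have h2 : (2 : ℝ) ≤ ((n + 1 : ℕ) : ℝ) + 1 := by
      push_cast
      linarith [n.cast_nonneg (α := ℝ)]
    refine Real.Gamma_strictMonoOn_Ici.monotoneOn h2 hs ?_
    push_cast at hlo ⊢
    linarith
  have hexp : C ^ (n + 1) ≤ Real.exp C * (n + 1).factorial :=
    (div_le_iff₀ (by positivity)).1 (Real.pow_div_factorial_le_exp C (by linarith) (n + 1))
  calc C ^ s ≤ C ^ ((n + 3 : ℕ) : ℝ) := Real.rpow_le_rpow_of_exponent_le hC hhi
    _ = C ^ 2 * C ^ (n + 1) := by rw [Real.rpow_natCast]; ring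
    _ ≤ C ^ 2 * (Real.exp C * (n + 1).factorial) := by gcongr
    _ ≤ C ^ 2 * (Real.exp C * Real.Gamma s) := by gcongr
    _ = C ^ 2 * Real.exp C * Real.Gamma s := by ring

/-- The Mittag-Leffler series converges everywhere. -/
theorem summable_mlE {α : ℝ} (hα : 0 < α) (β x : ℝ) :
    Summable fun k : ℕ => x ^ k / Real.Gamma (α * k + β) := by
  set D : ℝ := 2 * (|x| + 1) with hD
  have hD1 : 1 ≤ D := by linarith [abs_nonneg x]
  set C : ℝ := D ^ α⁻¹ with hCdef
  have hC : 1 ≤ C := Real.one_le_rpow hD1 (by positivity)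
  have hC0 : 0 < C := by linarith
  have hCα : C ^ α = D := Real.rpow_inv_rpow (by linarith) hα.ne'
  have hgeom : Summable fun k : ℕ => C ^ 2 * Real.exp C * C ^ (-β) * (1 / 2 : ℝ) ^ k :=
    summable_geometric_two.mul_left _
  refine hgeom.of_norm_bounded_eventually_nat ?_
  have hlarge : Filter.Tendsto (fun k : ℕ => α * (k : ℝ) + β) Filter.atTop Filter.atTop :=
    Filter.tendsto_atTop_add_const_right _ _
      (tendsto_natCast_atTop_atTop.const_mul_atTop hα)
  filter_upwards [hlarge.eventually_ge_atTop 2] with k hk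
  have hΓ : 0 < Real.Gamma (α * k + β) := Real.Gamma_pos_of_pos (by linarith)
  have hmain := rpow_le_mul_Gamma hC hk
  rw [Real.rpow_add hC0, Real.rpow_mul hC0.le, hCα, Real.rpow_natCast] at hmain
  have hxD : |x| ^ k ≤ D ^ k * (1 / 2) ^ k := by
    rw [← mul_pow]
    exact pow_le_pow_left₀ (abs_nonneg x) (by rw [hD]; linarith) k
  have hβ : C ^ β * C ^ (-β) = 1 := by
    rw [← Real.rpow_add hC0, add_neg_cancel, Real.rpow_zero]
  rw [norm_div, norm_pow, Real.norm_eq_abs, Real.norm_eq_abs, abs_of_pos hΓ, div_le_iff₀ hΓ]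
  calc |x| ^ k ≤ D ^ k * (1 / 2) ^ k := hxD
    _ = D ^ k * C ^ β * (C ^ (-β) * (1 / 2) ^ k) := by
      linear_combination -(D ^ k * (1 / 2) ^ k) * hβ
    _ ≤ C ^ 2 * Real.exp C * Real.Gamma (α * k + β) * (C ^ (-β) * (1 / 2) ^ k) := by gcongr
    _ = C ^ 2 * Real.exp C * C ^ (-β) * (1 / 2) ^ k * Real.Gamma (α * k + β) := by ring

/-- Termwise derivative of the series for `t ^ β * E_{α,β+1}(c t ^ α)`. -/
theorem hasDerivAt_mlE_term {α β : ℝ} (hα : 0 < α) (hβ : 0 < β) (c : ℝ) (k : ℕ) {t : ℝ}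
    (ht : 0 < t) :
    HasDerivAt (fun y : ℝ => y ^ β * ((c * y ^ α) ^ k / Real.Gamma (α * k + (β + 1))))
      (t ^ (β - 1) * ((c * t ^ α) ^ k / Real.Gamma (α * k + β))) t := by
  have hpow : ∀ {y : ℝ}, 0 < y → ∀ b : ℝ, y ^ b * (c * y ^ α) ^ k = c ^ k * y ^ (α * k + b) := by
    intro y hy b
    rw [mul_pow, Real.rpow_add hy, Real.rpow_mul hy.le, Real.rpow_natCast]
    ring
  have hs : 0 < α * k + β := by positivity
  have hΓ : Real.Gamma (α * k + β) ≠ 0 := (Real.Gamma_pos_of_pos hs).ne'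
  have hd := ((Real.hasDerivAt_rpow_const (p := α * k + β) (Or.inl ht.ne')).const_mul
    (c ^ k)).div_const (Real.Gamma (α * k + (β + 1)))
  refine (hd.congr_of_eventuallyEq ?_).congr_deriv ?_
  · filter_upwards [lt_mem_nhds ht] with y hy
    rw [← mul_div_assoc, hpow hy]
  · rw [← mul_div_assoc, hpow ht, ← add_assoc, Real.Gamma_add_one hs.ne', ← add_sub_assoc]
    field_simp

/-- For `α, β > 0`, `λ ∈ ℝ` and `t > 0`,
`d/dt [ t^β E_{α,β+1}(−λ t^α) ] = t^{β−1} E_{α,β}(−λ t^α)`. -/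
theorem mlE_hasDerivAt
    (α β lam : ℝ) (hα : 0 < α) (hβ : 0 < β) (t : ℝ) (ht : 0 < t) :
    HasDerivAt (fun t : ℝ => t ^ β * mlE α (β + 1) (-lam * t ^ α))
      (t ^ (β - 1) * mlE α β (-lam * t ^ α)) t := by
  simp only [mlE, ← tsum_mul_left]
  set M : ℝ := (t / 2) ^ (β - 1) + (2 * t) ^ (β - 1)
  have htmem : t ∈ Set.Ioo (t / 2) (2 * t) := ⟨by linarith, by linarith⟩
  refine hasDerivAt_tsum_of_isPreconnected
    (u := fun k : ℕ => M * ((|lam| * (2 * t) ^ α) ^ k / Real.Gamma (α * k + β)))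
    ((summable_mlE hα β _).mul_left M) isOpen_Ioo isPreconnected_Ioo
    (fun k y hy => hasDerivAt_mlE_term hα hβ (-lam) k (by linarith [hy.1])) ?_ htmem
    ((summable_mlE hα (β + 1) _).mul_left _) htmem
  intro k y hy
  have hy0 : 0 < y := by linarith [hy.1]
  have hΓ : 0 < Real.Gamma (α * k + β) := Real.Gamma_pos_of_pos (by positivity)
  have hM : y ^ (β - 1) ≤ M := by
    have h1 : 0 ≤ (t / 2) ^ (β - 1) := by positivity
    have h2 : 0 ≤ (2 * t) ^ (β - 1) := by positivity
    rcases le_total 0 (β - 1) with h | h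
    · exact (Real.rpow_le_rpow hy0.le hy.2.le h).trans (le_add_of_nonneg_left h1)
    · exact (Real.rpow_le_rpow_of_nonpos (by positivity) hy.1.le h).trans
        (le_add_of_nonneg_right h2)
  have hyα : y ^ α ≤ (2 * t) ^ α := Real.rpow_le_rpow hy0.le hy.2.le hα.le
  rw [norm_mul, norm_div, norm_pow, norm_mul, norm_neg, Real.norm_of_nonneg hΓ.le,
    Real.norm_of_nonneg (Real.rpow_nonneg hy0.le _),
    Real.norm_of_nonneg (Real.rpow_nonneg hy0.le _),
    Real.norm_eq_abs]
  gcongr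
end

section
/- Let 0 < α ≤ 1 and β ≥ α. Then the function x ↦ E_{α,β}(−x) is nonnegative and nonincreasing on [0,∞); in particular 0 ≤ E_{α,β}(−x) ≤ E_{α,β}(0) = 1/Γ(β) for all x ≥ 0. -/
open Set

theorem ascPochhammer_eval_eq_prod (a : ℝ) (n : ℕ) :
    (ascPochhammer ℝ n).eval a = ∏ j ∈ Finset.range n, (a + j) := by
  induction n with
  | zero => simp
  | succ n ih => rw [ascPochhammer_succ_eval, Finset.prod_range_succ, ih]

theorem multichoose_eq_prod_div (a : ℝ) (n : ℕ) :
    Ring.multichoose a n = (∏ j ∈ Finset.range n, (a + j)) / n.factorial := by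
  have h := Ring.factorial_nsmul_multichoose_eq_ascPochhammer a n
  rw [Polynomial.ascPochhammer_smeval_eq_eval, ascPochhammer_eval_eq_prod, nsmul_eq_mul] at h
  rw [← h, mul_div_cancel_left₀ _ (by positivity)]

theorem multichoose_nonneg {a : ℝ} (ha : 0 ≤ a) (n : ℕ) : 0 ≤ Ring.multichoose a n := by
  rw [multichoose_eq_prod_div]
  exact div_nonneg (Finset.prod_nonneg fun j _ => by positivity) (by positivity)

theorem multichoose_neg_succ_nonpos {a : ℝ} (ha : 0 ≤ a) (ha1 : a ≤ 1) (n : ℕ) :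
    Ring.multichoose (-a) (n + 1) ≤ 0 := by
  rw [multichoose_eq_prod_div, Finset.prod_range_succ']
  refine div_nonpos_of_nonpos_of_nonneg (mul_nonpos_of_nonneg_of_nonpos
    (Finset.prod_nonneg fun j _ => ?_) (by simpa using ha)) (by positivity)
  push_cast
  linarith [(Nat.cast_nonneg j : (0 : ℝ) ≤ j)]

/-- The formal power series of `(1 - X) ^ (-a)`. -/
noncomputable def oneSubRpowNeg (a : ℝ) : PowerSeries ℝ :=
  PowerSeries.mk fun n => Ring.multichoose a n

theorem oneSubRpowNeg_eq_rescale (a : ℝ) :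
    oneSubRpowNeg a = PowerSeries.rescale (-1) (PowerSeries.binomialSeries ℝ (-a)) := by
  ext n
  rw [oneSubRpowNeg, PowerSeries.coeff_mk, PowerSeries.coeff_rescale,
    PowerSeries.binomialSeries_coeff, Ring.choose_neg', smul_eq_mul, mul_one, Units.smul_def,
    zsmul_eq_mul, Int.cast_negOnePow_natCast, ← mul_assoc, ← mul_pow]
  simp

theorem oneSubRpowNeg_add (a b : ℝ) :
    oneSubRpowNeg (a + b) = oneSubRpowNeg a * oneSubRpowNeg b := by
  simp only [oneSubRpowNeg_eq_rescale, neg_add, PowerSeries.binomialSeries_add, map_mul]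

/-- If `P` has positive constant coefficient and nonpositive other coefficients, then
multiplication by `P` reflects nonnegativity of coefficients. -/
theorem PowerSeries.coeff_nonneg_of_coeff_mul_nonneg {P G : PowerSeries ℝ}
    (h0 : 0 < P.coeff 0) (hP : ∀ n, P.coeff (n + 1) ≤ 0) (hPG : ∀ n, 0 ≤ (P * G).coeff n)
    (n : ℕ) : 0 ≤ G.coeff n := by
  induction n using Nat.strong_induction_on with
  | _ n ih =>
    have h := hPG n
    rw [PowerSeries.coeff_mul, Finset.Nat.sum_antidiagonal_eq_sum_range_succ_mk,
      Finset.sum_range_succ'] at h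
    have hs : ∑ k ∈ Finset.range n, P.coeff (k + 1) * G.coeff (n - (k + 1)) ≤ 0 :=
      Finset.sum_nonpos fun k hk => mul_nonpos_of_nonpos_of_nonneg (hP k)
        (ih _ (by have := Finset.mem_range.1 hk; omega))
    refine nonneg_of_mul_nonneg_right (a := P.coeff 0) ?_ h0
    simp only [Nat.sub_zero] at h
    linarith

theorem summable_geometric_mul_polynomial_eval {r : ℝ} (hr : |r| < 1) (P : Polynomial ℝ) :
    Summable fun k : ℕ => r ^ k * P.eval (k : ℝ) := by
  induction P using Polynomial.induction_on' with
  | add p q hp hq => simpa [mul_add] using hp.add hq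
  | monomial n a =>
    have h := (summable_pow_mul_geometric_of_norm_lt_one n
      (by simpa [Real.norm_eq_abs] using hr : ‖r‖ < 1)).mul_left a
    refine h.congr fun k => ?_
    rw [Polynomial.eval_monomial]
    ring

theorem summable_geometric_mul_prod {r : ℝ} (hr : |r| < 1) (a b : ℝ) (n : ℕ) :
    Summable fun k : ℕ => r ^ k * ∏ j ∈ Finset.range n, (a * k + b + j) := by
  refine (summable_geometric_mul_polynomial_eval hr
    (∏ j ∈ Finset.range n, (Polynomial.C a * Polynomial.X + Polynomial.C (b + j)))).congr
    fun k => ?_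
  simp [Polynomial.eval_prod, add_assoc]

theorem summable_geometric_mul_multichoose {r : ℝ} (hr : |r| < 1) (a b : ℝ) (n : ℕ) :
    Summable fun k : ℕ => r ^ k * Ring.multichoose (a * k + b) n := by
  refine ((summable_geometric_mul_prod hr a b n).div_const (n.factorial : ℝ)).congr fun k => ?_
  rw [multichoose_eq_prod_div, mul_div_assoc]

/-- The discrete Mittag-Leffler series, `∑ₖ (-r)^k (1 - X)^(-(a k + b))`, which is the expansion of
`(1 - X)^(a - b) / ((1 - X)^a + r)`. -/
noncomputable def discreteML (a b r : ℝ) : PowerSeries ℝ :=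
  PowerSeries.mk fun n => ∑' k : ℕ, (-r) ^ k * Ring.multichoose (a * k + b) n

theorem mul_discreteML {r : ℝ} (hr : |r| < 1) (a b : ℝ) :
    (oneSubRpowNeg (-a) + PowerSeries.C r) * discreteML a b r = oneSubRpowNeg (b - a) := by
  have hr' : |-r| < 1 := by rwa [abs_neg]
  have key : oneSubRpowNeg (-a) * discreteML a b r = discreteML a (b - a) r := by
    ext n
    rw [PowerSeries.coeff_mul]
    simp only [discreteML, PowerSeries.coeff_mk, oneSubRpowNeg, ← tsum_mul_left]
    have hsum (i : ℕ × ℕ) (_ : i ∈ Finset.HasAntidiagonal.antidiagonal n) :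
        Summable fun k : ℕ => Ring.multichoose (-a) i.1 *
          ((-r) ^ k * Ring.multichoose (a * k + b) i.2) :=
      (summable_geometric_mul_multichoose hr' a b i.2).mul_left (Ring.multichoose (-a) i.1)
    rw [← Summable.tsum_finsetSum hsum]
    refine tsum_congr fun k => ?_
    have h := congrArg (PowerSeries.coeff n) (oneSubRpowNeg_add (-a) (a * k + b))
    rw [PowerSeries.coeff_mul] at h
    simp only [oneSubRpowNeg, PowerSeries.coeff_mk] at h
    rw [show a * k + (b - a) = -a + (a * k + b) by ring, h, Finset.mul_sum]
    exact Finset.sum_congr rfl fun i _ => by ring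
  rw [add_mul, key]
  ext n
  rw [map_add, PowerSeries.coeff_C_mul]
  simp only [discreteML, PowerSeries.coeff_mk, oneSubRpowNeg]
  rw [(summable_geometric_mul_multichoose hr' a (b - a) n).tsum_eq_zero_add, ← tsum_mul_left,
    add_assoc, ← Summable.tsum_add]
  · rw [tsum_congr (g := fun _ => (0 : ℝ))]
    · simp
    · intro k
      rw [show a * ((k + 1 : ℕ) : ℝ) + (b - a) = a * k + b by push_cast; ring]
      ring
  · exact (summable_nat_add_iff 1).2 (summable_geometric_mul_multichoose hr' a (b - a) n)
  · exact (summable_geometric_mul_multichoose hr' a b n).mul_left r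

theorem coeff_nonneg_of_mul_oneSub {a r : ℝ} (ha : 0 ≤ a) (ha1 : a ≤ 1) (hr : 0 ≤ r)
    {G : PowerSeries ℝ}
    (h : ∀ n, 0 ≤ ((oneSubRpowNeg (-a) + PowerSeries.C r) * G).coeff n) (n : ℕ) :
    0 ≤ G.coeff n := by
  refine PowerSeries.coeff_nonneg_of_coeff_mul_nonneg ?_ (fun m => ?_) h n
  · simp [oneSubRpowNeg]
    linarith
  · simpa [oneSubRpowNeg, PowerSeries.coeff_C] using multichoose_neg_succ_nonpos ha ha1 m

theorem discreteML_coeff_nonneg {a b r : ℝ} (ha : 0 ≤ a) (ha1 : a ≤ 1) (hb : a ≤ b)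
    (hr : 0 ≤ r) (hr1 : r < 1) (n : ℕ) : 0 ≤ (discreteML a b r).coeff n := by
  refine coeff_nonneg_of_mul_oneSub ha ha1 hr (fun m => ?_) n
  rw [mul_discreteML (by rwa [abs_of_nonneg hr]), oneSubRpowNeg, PowerSeries.coeff_mk]
  exact multichoose_nonneg (sub_nonneg.2 hb) m

theorem discreteML_coeff_antitone {a b r s : ℝ} (ha : 0 ≤ a) (ha1 : a ≤ 1) (hb : a ≤ b)
    (hr : 0 ≤ r) (hrs : r ≤ s) (hs : s < 1) (n : ℕ) :
    (discreteML a b s).coeff n ≤ (discreteML a b r).coeff n := by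
  have h1 := mul_discreteML (a := a) (b := b) (abs_lt.2 ⟨by linarith, hrs.trans_lt hs⟩ : |r| < 1)
  have h2 := mul_discreteML (a := a) (b := b) (abs_lt.2 ⟨by linarith, hs⟩ : |s| < 1)
  have h3 : (oneSubRpowNeg (-a) + PowerSeries.C r) * (discreteML a b r - discreteML a b s) =
      PowerSeries.C (s - r) * discreteML a b s := by
    rw [map_sub]
    linear_combination h1 - h2
  have h4 := coeff_nonneg_of_mul_oneSub ha ha1 hr (G := discreteML a b r - discreteML a b s)
    (fun m => by
      rw [h3, PowerSeries.coeff_C_mul]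
      exact mul_nonneg (sub_nonneg.2 hrs)
        (discreteML_coeff_nonneg ha ha1 hb (hr.trans hrs) hs m)) n
  rw [map_sub] at h4
  linarith

theorem Real.GammaSeq_pos {s : ℝ} (hs : 0 < s) {n : ℕ} (hn : n ≠ 0) : 0 < Real.GammaSeq s n := by
  rw [Real.GammaSeq]
  have : 0 < (n : ℝ) := by positivity
  have : 0 < ∏ j ∈ Finset.range (n + 1), (s + j) := Finset.prod_pos fun j _ => by positivity
  positivity

theorem Real.GammaSeq_le_succ {s : ℝ} (hs : 0 < s) {n : ℕ} (hn : n ≠ 0) :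
    Real.GammaSeq s n ≤ Real.GammaSeq s (n + 1) := by
  have hn0 : 0 < (n : ℝ) := by positivity
  have hP : 0 < ∏ j ∈ Finset.range (n + 1), (s + j) := Finset.prod_pos fun j _ => by positivity
  have hlog : 1 / ((n : ℝ) + 1) ≤ Real.log ((n + 1) / n) := by
    refine le_trans (le_of_eq ?_) (Real.one_sub_inv_le_log_of_pos (by positivity))
    field_simp
    ring
  have hpow : (n : ℝ) ^ s * (1 + s / (n + 1)) ≤ ((n : ℝ) + 1) ^ s := by
    have h : 1 + s / ((n : ℝ) + 1) ≤ (((n : ℝ) + 1) / n) ^ s := by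
      rw [Real.rpow_def_of_pos (by positivity)]
      have := mul_le_mul_of_nonneg_right hlog hs.le
      have e := Real.add_one_le_exp (Real.log (((n : ℝ) + 1) / n) * s)
      have : 1 / ((n : ℝ) + 1) * s = s / (n + 1) := by ring
      linarith
    calc (n : ℝ) ^ s * (1 + s / (n + 1)) ≤ (n : ℝ) ^ s * (((n : ℝ) + 1) / n) ^ s := by gcongr
      _ = ((n : ℝ) + 1) ^ s := by
        rw [← Real.mul_rpow (by positivity) (by positivity)]
        congr 1
        field_simp
  rw [Real.GammaSeq, Real.GammaSeq, Finset.prod_range_succ _ (n + 1), Nat.factorial_succ,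
    div_le_div_iff₀ hP (by positivity)]
  push_cast
  calc (n : ℝ) ^ s * n.factorial * ((∏ j ∈ Finset.range (n + 1), (s + j)) * (s + (n + 1)))
      = ((n : ℝ) ^ s * (1 + s / (n + 1))) *
        (((n : ℝ) + 1) * n.factorial * ∏ j ∈ Finset.range (n + 1), (s + j)) := by
        field_simp
        ring
    _ ≤ ((n : ℝ) + 1) ^ s *
        (((n : ℝ) + 1) * n.factorial * ∏ j ∈ Finset.range (n + 1), (s + j)) := by gcongr
    _ = _ := by ring

theorem Real.GammaSeq_le_GammaSeq {s : ℝ} (hs : 0 < s) {m n : ℕ} (hm : m ≠ 0) (hmn : m ≤ n) :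
    Real.GammaSeq s m ≤ Real.GammaSeq s n := by
  induction n, hmn using Nat.le_induction with
  | base => exact le_rfl
  | succ k hk ih => exact ih.trans (Real.GammaSeq_le_succ hs (by omega))

theorem pow_div_GammaSeq {a b x : ℝ} {n : ℕ} (hn : n ≠ 0) (k : ℕ) :
    x ^ k / Real.GammaSeq (a * k + b) n =
      ((n : ℝ) ^ b * n.factorial)⁻¹ *
        ((x / (n : ℝ) ^ a) ^ k * ∏ j ∈ Finset.range (n + 1), (a * k + b + j)) := by
  have hn0 : 0 < (n : ℝ) := by positivity
  rw [Real.GammaSeq, Real.rpow_add hn0, Real.rpow_mul hn0.le, Real.rpow_natCast, div_pow]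
  field_simp

theorem tsum_pow_div_GammaSeq {a b x : ℝ} {n : ℕ} (hn : n ≠ 0) :
    ∑' k : ℕ, (-x) ^ k / Real.GammaSeq (a * k + b) n =
      (n + 1) / (n : ℝ) ^ b * (discreteML a b (x / (n : ℝ) ^ a)).coeff (n + 1) := by
  rw [discreteML, PowerSeries.coeff_mk, ← tsum_mul_left]
  refine tsum_congr fun k => ?_
  have hn0 : 0 < (n : ℝ) := by positivity
  rw [pow_div_GammaSeq hn, multichoose_eq_prod_div, Nat.factorial_succ, neg_div]
  push_cast
  field_simp

open Filter Topology in
theorem eventually_div_rpow_lt_one {a : ℝ} (ha : 0 < a) (x : ℝ) :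
    ∀ᶠ n : ℕ in atTop, x / (n : ℝ) ^ a < 1 := by
  have h : Tendsto (fun n : ℕ => (n : ℝ) ^ a) atTop atTop :=
    (tendsto_rpow_atTop ha).comp tendsto_natCast_atTop_atTop
  exact (h.const_div_atTop x).eventually (gt_mem_nhds one_pos)

open Filter Topology in
theorem tendsto_tsum_pow_div_GammaSeq {a b x : ℝ} (ha : 0 < a) (hb : 0 < b) (hx : 0 ≤ x) :
    Tendsto (fun n : ℕ => ∑' k : ℕ, (-x) ^ k / Real.GammaSeq (a * k + b) n) atTop
      (𝓝 (mlE a b (-x))) := by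
  obtain ⟨m, hm1, hm⟩ := ((eventually_div_rpow_lt_one ha x).and (eventually_ne_atTop 0)).exists
  have hpos (k : ℕ) : 0 < a * k + b := by positivity
  refine tendsto_tsum_of_dominated_convergence
    (bound := fun k : ℕ => x ^ k / Real.GammaSeq (a * k + b) m) ?_ (fun k => ?_) ?_
  · simp only [pow_div_GammaSeq hm]
    refine (summable_geometric_mul_prod ?_ a b (m + 1)).mul_left _
    rwa [abs_of_nonneg (by positivity)]
  · exact tendsto_const_nhds.div (Real.GammaSeq_tendsto_Gamma _)
      (Real.Gamma_pos_of_pos (hpos k)).ne'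
  · filter_upwards [eventually_ge_atTop m] with n hn k
    have h0 := Real.GammaSeq_pos (hpos k) hm
    have h1 := Real.GammaSeq_le_GammaSeq (hpos k) hm hn
    rw [norm_div, norm_pow, norm_neg, Real.norm_of_nonneg hx, Real.norm_of_nonneg (h0.trans_le h1).le]
    gcongr

/-- For `0 < α ≤ 1` and `β ≥ α`, the function `x ↦ E_{α,β}(−x)` is nonnegative
and nonincreasing on `[0,∞)`; in particular
`0 ≤ E_{α,β}(−x) ≤ E_{α,β}(0) = 1/Γ(β)` for `x ≥ 0`. -/
theorem mlE_nonneg_antitone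
    (α β : ℝ) (hα : 0 < α) (hα1 : α ≤ 1) (hβ : α ≤ β) :
    (∀ x : ℝ, 0 ≤ x → 0 ≤ mlE α β (-x)) ∧
    AntitoneOn (fun x : ℝ => mlE α β (-x)) (Ici 0) ∧
    (∀ x : ℝ, 0 ≤ x → mlE α β (-x) ≤ 1 / Real.Gamma β) ∧
    mlE α β 0 = 1 / Real.Gamma β := by
  have hβ0 : 0 < β := hα.trans_le hβ
  have anti : AntitoneOn (fun x : ℝ => mlE α β (-x)) (Ici 0) := by
    intro x hx y hy hxy
    rw [mem_Ici] at hx hy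
    refine le_of_tendsto_of_tendsto (tendsto_tsum_pow_div_GammaSeq hα hβ0 hy)
      (tendsto_tsum_pow_div_GammaSeq hα hβ0 hx) ?_
    filter_upwards [eventually_div_rpow_lt_one hα y, Filter.eventually_ne_atTop 0] with n h1 hn
    rw [tsum_pow_div_GammaSeq hn, tsum_pow_div_GammaSeq hn]
    exact mul_le_mul_of_nonneg_left
      (discreteML_coeff_antitone hα.le hα1 hβ (by positivity) (by gcongr) h1 _) (by positivity)
  have zero : mlE α β 0 = 1 / Real.Gamma β := by
    rw [mlE, tsum_eq_single 0 fun k hk => by simp [hk]]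
    simp
  refine ⟨fun x hx => ?_, anti, fun x hx => ?_, zero⟩
  · refine ge_of_tendsto (tendsto_tsum_pow_div_GammaSeq hα hβ0 hx) ?_
    filter_upwards [eventually_div_rpow_lt_one hα x, Filter.eventually_ne_atTop 0] with n h1 hn
    rw [tsum_pow_div_GammaSeq hn]
    exact mul_nonneg (by positivity)
      (discreteML_coeff_nonneg hα.le hα1 hβ (by positivity) h1 _)
  · simpa [zero] using anti self_mem_Ici hx hx
end

section
/- Let 0 < α < 1 and β > 0. There exists a constant C > 0, depending only on α and β, such that |E_{α,β}(−x)| ≤ C / (1 + x) for all real x ≥ 0. -/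
open MeasureTheory Filter Topology Set

/-- A dominated parametric integral of holomorphic functions is holomorphic. -/
theorem differentiableOn_integral_of_dominated {X : Type*} [MeasurableSpace X] {μ : Measure X}
    {F : ℂ → X → ℂ} {U : Set ℂ} {bound : X → ℝ} (hU : IsOpen U) (hb : Integrable bound μ)
    (hm : ∀ z ∈ U, AEStronglyMeasurable (F z) μ)
    (hd : ∀ᵐ a ∂μ, DifferentiableOn ℂ (F · a) U)
    (hle : ∀ᵐ a ∂μ, ∀ z ∈ U, ‖F z a‖ ≤ bound a) :
    DifferentiableOn ℂ (fun z ↦ ∫ a, F z a ∂μ) U := by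
  intro z₀ hz₀
  obtain ⟨ε, hε, hεU⟩ := Metric.isOpen_iff.1 hU z₀ hz₀
  have hball : ∀ z ∈ Metric.ball z₀ (ε / 2), Metric.closedBall z (ε / 4) ⊆ U := by
    intro z hz w hw
    apply hεU
    have := dist_triangle w z z₀
    simp only [Metric.mem_ball, Metric.mem_closedBall] at *
    linarith
  have hmem : ∀ z ∈ Metric.ball z₀ (ε / 2), z ∈ U := fun z hz ↦
    hball z hz (Metric.mem_closedBall_self (by positivity))
  have hderiv : ∀ᵐ a ∂μ, ∀ z ∈ Metric.ball z₀ (ε / 2),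
      HasDerivAt (F · a) (deriv (F · a) z) z := by
    filter_upwards [hd] with a ha z hz
    exact ((ha z (hmem z hz)).differentiableAt (hU.mem_nhds (hmem z hz))).hasDerivAt
  refine (hasDerivAt_integral_of_dominated_loc_of_deriv_le (𝕜 := ℂ)
    (F' := fun z a ↦ deriv (F · a) z) (bound := fun a ↦ bound a / (ε / 4))
    (Metric.ball_mem_nhds z₀ (half_pos hε)) ?_ ?_ ?_ ?_ (hb.div_const _)
    hderiv).2.differentiableAt.differentiableWithinAt
  · filter_upwards [hU.mem_nhds hz₀] with z hz using hm z hz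
  · exact hb.mono' (hm z₀ hz₀) (hle.mono fun a ha ↦ ha z₀ hz₀)
  · have hlim : Tendsto (fun n : ℕ ↦ z₀ + ((ε / 2 / (n + 2) : ℝ) : ℂ)) atTop (𝓝[≠] z₀) := by
      refine tendsto_nhdsWithin_iff.2 ⟨?_, Eventually.of_forall fun n ↦ ?_⟩
      · have h1 : Tendsto (fun n : ℕ ↦ ε / 2 / ((n : ℝ) + 2)) atTop (𝓝 0) :=
          (tendsto_natCast_atTop_atTop.atTop_add tendsto_const_nhds).const_div_atTop _
        have h2 := (Complex.continuous_ofReal.tendsto 0).comp h1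
        simpa using h2.const_add z₀
      · have : (ε / 2 / ((n : ℝ) + 2) : ℝ) ≠ 0 := by positivity
        simpa only [mem_compl_iff, mem_singleton_iff, add_eq_left, Complex.ofReal_eq_zero]
    refine aestronglyMeasurable_of_tendsto_ae atTop
      (f := fun (n : ℕ) a ↦ slope (F · a) z₀ (z₀ + ((ε / 2 / (n + 2) : ℝ) : ℂ))) (fun n ↦ ?_) ?_
    · simp only [slope_def_field, div_eq_mul_inv (_ - _)]
      refine ((hm _ ?_).sub (hm _ hz₀)).mul_const _
      apply hmem
      simp only [Metric.mem_ball, dist_self_add_left, Complex.norm_real, Real.norm_eq_abs]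
      rw [abs_of_pos (by positivity)]
      exact div_lt_self (by positivity) (by linarith [Nat.cast_nonneg (α := ℝ) n])
    · filter_upwards [hderiv] with a ha
      exact (hasDerivAt_iff_tendsto_slope.1
        (ha z₀ (Metric.mem_ball_self (half_pos hε)))).comp hlim
  · filter_upwards [hd, hle] with a ha hla z hz
    refine Complex.norm_deriv_le_of_forall_mem_sphere_norm_le (by positivity) ?_ ?_
    · exact (ha.mono (by
        rw [closure_ball _ (by positivity)]; exact hball z hz)).diffContOnCl
    · exact fun w hw ↦ hla w (hball z hz (Metric.sphere_subset_closedBall hw))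

/-- The Laplace transform of `t ^ (s - 1)` at complex arguments. -/
theorem integral_cpow_mul_exp_neg_complex_mul {s : ℝ} (hs : 0 < s) {w : ℂ} (hw : 1 / 2 < w.re) :
    ∫ t : ℝ in Ioi 0, (t : ℂ) ^ ((s : ℂ) - 1) * Complex.exp (-(w * t)) =
      w ^ (-(s : ℂ)) * Complex.Gamma s := by
  set U : Set ℂ := {z | 1 / 2 < z.re}
  have hU : IsOpen U := isOpen_lt continuous_const Complex.continuous_re
  have hne : ∀ z ∈ U, z ∈ Complex.slitPlane := fun z hz ↦
    Or.inl (lt_trans (by norm_num) (show 1 / 2 < z.re from hz))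
  have hL : DifferentiableOn ℂ (fun z : ℂ ↦ ∫ t : ℝ in Ioi 0,
      (t : ℂ) ^ ((s : ℂ) - 1) * Complex.exp (-(z * t))) U := by
    refine differentiableOn_integral_of_dominated hU
      (bound := fun t ↦ t ^ (s - 1) * Real.exp (-(1 / 2) * t)) ?_ ?_ ?_ ?_
    · have := integrableOn_rpow_mul_exp_neg_mul_rpow (s := s - 1) (p := 1) (b := 1 / 2)
        (by linarith) one_pos (by norm_num)
      simpa [IntegrableOn] using this
    · intro z hz
      refine ContinuousOn.aestronglyMeasurable (fun t ht ↦ ContinuousAt.continuousWithinAt ?_)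
        measurableSet_Ioi
      exact (Complex.continuousAt_ofReal_cpow_const t _ (Or.inr (ne_of_gt ht))).mul (by fun_prop)
    · exact Eventually.of_forall fun t ↦ by fun_prop
    · refine (ae_restrict_iff' measurableSet_Ioi).2 (Eventually.of_forall fun t ht z hz ↦ ?_)
      have ht : 0 < t := ht
      have hz : 1 / 2 < z.re := hz
      rw [norm_mul, Complex.norm_cpow_eq_rpow_re_of_pos ht, Complex.norm_exp]
      simp only [Complex.sub_re, Complex.ofReal_re, Complex.one_re, Complex.neg_re,
        Complex.mul_re, Complex.ofReal_im, mul_zero, sub_zero]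
      gcongr
      nlinarith
  have hR : DifferentiableOn ℂ (fun z : ℂ ↦ z ^ (-(s : ℂ)) * Complex.Gamma s) U := fun z hz ↦
    ((differentiableAt_id.cpow_const (hne z hz)).mul_const _).differentiableWithinAt
  have hconv : IsPreconnected U := (convex_halfSpace_re_gt (1 / 2)).isPreconnected
  refine (hL.analyticOnNhd hU).eqOn_of_preconnected_of_frequently_eq (hR.analyticOnNhd hU) hconv
    (z₀ := 1) (by simp [U]; norm_num) ?_ hw
  have hlim : Tendsto (fun n : ℕ ↦ (1 : ℂ) + ((1 / ((n : ℝ) + 1) : ℝ) : ℂ)) atTop (𝓝[≠] 1) := by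
    refine tendsto_nhdsWithin_iff.2 ⟨?_, Eventually.of_forall fun n ↦ ?_⟩
    · have h2 := (Complex.continuous_ofReal.tendsto 0).comp
        (tendsto_one_div_add_atTop_nhds_zero_nat (𝕜 := ℝ))
      simpa using h2.const_add 1
    · have : (1 / ((n : ℝ) + 1) : ℝ) ≠ 0 := by positivity
      simpa only [mem_compl_iff, mem_singleton_iff, add_eq_left, Complex.ofReal_eq_zero]
  refine hlim.frequently (Eventually.of_forall fun n ↦ ?_).frequently
  have hr : (0 : ℝ) < 1 + 1 / ((n : ℝ) + 1) := by positivity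
  have := Complex.integral_cpow_mul_exp_neg_mul_Ioi (a := s) (by simpa using hs) hr
  simp only [Complex.ofReal_add, Complex.ofReal_one] at this
  rw [this, one_div, Complex.inv_cpow, Complex.cpow_neg]
  rw [← Complex.ofReal_one, ← Complex.ofReal_add, Complex.arg_ofReal_of_nonneg hr.le]
  exact Real.pi_pos.ne

/-- The point `1 + 2πiξ` on the vertical line through `1`. -/
noncomputable def verticalLine (ξ : ℝ) : ℂ := 1 + 2 * Real.pi * ξ * Complex.I

theorem verticalLine_re (ξ : ℝ) : (verticalLine ξ).re = 1 := by
  simp [verticalLine]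

theorem one_le_norm_verticalLine (ξ : ℝ) : 1 ≤ ‖verticalLine ξ‖ := by
  simpa [verticalLine_re] using Complex.abs_re_le_norm (verticalLine ξ)

theorem verticalLine_mem_slitPlane (ξ : ℝ) : verticalLine ξ ∈ Complex.slitPlane :=
  Or.inl (by simp [verticalLine_re])

theorem verticalLine_ne_zero (ξ : ℝ) : verticalLine ξ ≠ 0 :=
  Complex.slitPlane_ne_zero (verticalLine_mem_slitPlane ξ)

theorem continuous_verticalLine : Continuous verticalLine := by
  unfold verticalLine; fun_prop

theorem continuous_verticalLine_cpow (c : ℂ) : Continuous fun ξ ↦ verticalLine ξ ^ c :=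
  continuous_verticalLine.cpow continuous_const verticalLine_mem_slitPlane

theorem integrable_norm_verticalLine_rpow {r : ℝ} (hr : 1 < r) :
    Integrable fun ξ ↦ ‖verticalLine ξ‖ ^ (-r) := by
  have h := (integrable_rpow_neg_one_add_norm_sq (E := ℝ) (μ := volume) (r := r)
    (by simpa using hr)).comp_mul_left' (R := 2 * Real.pi) (by positivity)
  refine h.congr (Eventually.of_forall fun ξ ↦ ?_)
  have : ‖verticalLine ξ‖ = (1 + ‖2 * Real.pi * ξ‖ ^ 2) ^ (1 / 2 : ℝ) := by
    rw [← Real.sqrt_eq_rpow, Complex.norm_def, Complex.normSq_apply, Real.norm_eq_abs, sq_abs]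
    simp [verticalLine]
    ring_nf
  simp only [this]
  rw [← Real.rpow_mul (by positivity)]
  ring_nf

/-- Laplace inversion for the reciprocal Gamma function. -/
theorem integral_exp_mul_verticalLine_cpow {s : ℝ} (hs : 1 < s) :
    ∫ ξ : ℝ, Complex.exp (verticalLine ξ) * verticalLine ξ ^ (-(s : ℂ)) =
      1 / Complex.Gamma s := by
  set f : ℝ → ℂ := (Ioi 0).indicator fun t : ℝ ↦ (t : ℂ) ^ ((s : ℂ) - 1) * Complex.exp (-t)
  have hΓ : Complex.Gamma s ≠ 0 := by
    rw [Complex.Gamma_ofReal]; exact_mod_cast (Real.Gamma_pos_of_pos (by linarith)).ne'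
  have hf : Integrable f := by
    refine (integrable_indicator_iff measurableSet_Ioi).2 ?_
    refine (Complex.GammaIntegral_convergent (s := s) (by simp; linarith)).congr_fun
      (fun t _ ↦ ?_) measurableSet_Ioi
    simp [mul_comm]
  have hF : ∀ ξ, FourierTransform.fourier f ξ =
      verticalLine ξ ^ (-(s : ℂ)) * Complex.Gamma s := by
    intro ξ
    rw [Real.fourier_real_eq_integral_exp_smul, ← integral_cpow_mul_exp_neg_complex_mul
      (by linarith) (by rw [verticalLine_re]; norm_num), ← integral_indicator measurableSet_Ioi]
    refine integral_congr_ae (Eventually.of_forall fun t ↦ ?_)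
    by_cases ht : t ∈ Ioi (0 : ℝ)
    · simp only [f, indicator_of_mem ht, smul_eq_mul]
      rw [mul_left_comm, ← Complex.exp_add]
      congr 2
      simp only [verticalLine]
      push_cast
      ring
    · simp [f, indicator_of_notMem ht]
  have hFi : Integrable (FourierTransform.fourier f) := by
    rw [funext hF]
    refine Integrable.mul_const ?_ _
    refine (integrable_norm_verticalLine_rpow hs).mono'
      (continuous_verticalLine_cpow _).aestronglyMeasurable (Eventually.of_forall fun ξ ↦ ?_)
    rw [← Complex.ofReal_neg, Complex.norm_cpow_real]
  have hc : ContinuousAt f 1 := by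
    have : ContinuousAt (fun t : ℝ ↦ (t : ℂ) ^ ((s : ℂ) - 1) * Complex.exp (-t)) 1 :=
      (Complex.continuousAt_ofReal_cpow_const 1 _ (Or.inr one_ne_zero)).mul (by fun_prop)
    refine this.congr ?_
    filter_upwards [Ioi_mem_nhds (zero_lt_one (α := ℝ))] with t ht
    simp [f, indicator_of_mem ht]
  have key := hf.fourierInv_fourier_eq hFi hc
  rw [Real.fourierInv_eq'] at key
  have hf1 : f 1 = Complex.exp (-1) := by simp [f]
  rw [hf1] at key
  rw [eq_div_iff hΓ, ← integral_mul_const]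
  calc _ = ∫ ξ : ℝ, Complex.exp 1 * (Complex.exp (↑(2 * Real.pi * inner ℝ ξ 1) * Complex.I) •
        FourierTransform.fourier f ξ) := by
        refine integral_congr_ae (Eventually.of_forall fun ξ ↦ ?_)
        simp only [hF, smul_eq_mul]
        rw [← mul_assoc, ← mul_assoc, ← Complex.exp_add]
        congr 3
        simp [verticalLine]
    _ = 1 := by
        rw [integral_const_mul, key, ← Complex.exp_add]; simp

theorem Real.rpow_mul_exp_neg_le_Gamma {T s : ℝ} (hT : 0 < T) (hs : 1 ≤ s) :
    T ^ (s - 1) * Real.exp (-T) ≤ Real.Gamma s := by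
  have hi := Real.GammaIntegral_convergent (s := s) (by linarith)
  have hsub : Ioi T ⊆ Ioi 0 := Ioi_subset_Ioi hT.le
  rw [Real.Gamma_eq_integral (by linarith)]
  calc T ^ (s - 1) * Real.exp (-T) = ∫ x in Ioi T, Real.exp (-x) * T ^ (s - 1) := by
        rw [integral_mul_const, integral_exp_neg_Ioi, mul_comm]
    _ ≤ ∫ x in Ioi T, Real.exp (-x) * x ^ (s - 1) := by
        refine setIntegral_mono_on ((integrableOn_exp_neg_Ioi T).mul_const _)
          (hi.mono_set hsub) measurableSet_Ioi fun x hx ↦ ?_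
        have hx : T < x := hx
        have : 0 ≤ s - 1 := by linarith
        gcongr
    _ ≤ ∫ x in Ioi 0, Real.exp (-x) * x ^ (s - 1) := by
        refine setIntegral_mono_set hi ?_ hsub.eventuallyLE
        refine (ae_restrict_iff' measurableSet_Ioi).2 (Eventually.of_forall fun x hx ↦ ?_)
        have hx : 0 < x := hx
        simp only [Pi.zero_apply]
        positivity

theorem summable_pow_div_Gamma {α β R : ℝ} (hα : 0 < α) (hR : 0 < R) :
    Summable fun k : ℕ ↦ R ^ k / Real.Gamma (α * k + β) := by
  set T := (2 * R) ^ (1 / α)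
  have hT : 0 < T := by positivity
  have hTα : T ^ α = 2 * R := by
    rw [← Real.rpow_mul (by positivity), one_div_mul_cancel hα.ne', Real.rpow_one]
  have hgeom : Summable fun k : ℕ ↦ (Real.exp T * T ^ (1 - β)) * (1 / 2 : ℝ) ^ k :=
    summable_geometric_two.mul_left _
  refine hgeom.of_norm_bounded_eventually_nat ?_
  filter_upwards [(tendsto_natCast_atTop_atTop.const_mul_atTop hα).eventually_ge_atTop (1 - β)]
    with k hk
  have hs : 1 ≤ α * k + β := by linarith
  have hle := Real.rpow_mul_exp_neg_le_Gamma hT hs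
  have hΓ : 0 < Real.Gamma (α * k + β) := Real.Gamma_pos_of_pos (by linarith)
  rw [Real.norm_of_nonneg (by positivity), div_le_iff₀ hΓ]
  calc R ^ k = (Real.exp T * T ^ (1 - β)) * (1 / 2 : ℝ) ^ k *
        (T ^ (α * k + β - 1) * Real.exp (-T)) := by
        have h1 : T ^ (1 - β) * T ^ (α * k + β - 1) = (2 * R) ^ k := by
          rw [← Real.rpow_add hT, ← hTα, ← Real.rpow_mul_natCast hT.le]
          ring_nf
        have h2 : Real.exp T * Real.exp (-T) = 1 := by rw [← Real.exp_add]; simp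
        calc R ^ k = (1 / 2 : ℝ) ^ k * (2 * R) ^ k := by rw [← mul_pow]; ring_nf
          _ = (Real.exp T * Real.exp (-T)) * ((1 / 2 : ℝ) ^ k *
              (T ^ (1 - β) * T ^ (α * k + β - 1))) := by rw [h1, h2, one_mul]
          _ = _ := by ring
    _ ≤ _ := by gcongr

/-- The Mittag-Leffler series is an entire function. -/
theorem differentiable_tsum_pow_div_Gamma {α : ℝ} (hα : 0 < α) (β : ℝ) :
    Differentiable ℂ fun z : ℂ ↦ ∑' k : ℕ, z ^ k / ((Real.Gamma (α * k + β) : ℝ) : ℂ) := by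
  intro z
  have hR : 0 < ‖z‖ + 1 := by positivity
  have := Complex.differentiableOn_tsum_of_summable_norm
    (F := fun (k : ℕ) (z : ℂ) ↦ z ^ k / ((Real.Gamma (α * k + β) : ℝ) : ℂ))
    (summable_pow_div_Gamma (β := β) hα hR).norm
    (fun k ↦ by fun_prop) (Metric.isOpen_ball (x := (0 : ℂ)) (ε := ‖z‖ + 1)) fun k w hw ↦ by
      have hw : ‖w‖ < ‖z‖ + 1 := by simpa using hw
      rw [norm_div, norm_div, norm_pow, norm_pow, Complex.norm_real, Real.norm_of_nonneg hR.le]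
      gcongr
  exact this.differentiableAt (Metric.isOpen_ball.mem_nhds (by simp))

/-- With `p = 1 / (1 - w)`, this is the sum of `(α k + β) (α k + β + 1) w ^ k`. -/
noncomputable def geomPoly (α β : ℝ) (p : ℂ) : ℂ :=
  p * (β * (β + 1) + α * (2 * β + 1) * (p - 1) + α ^ 2 * ((p - 1) * (2 * p - 1)))

theorem hasSum_geomPoly (α β : ℝ) {w : ℂ} (hw : ‖w‖ < 1) :
    HasSum (fun k : ℕ ↦ ((α : ℂ) * k + β) * (α * k + β + 1) * w ^ k)
      (geomPoly α β (1 / (1 - w))) := by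
  have h0 := hasSum_choose_mul_geometric_of_norm_lt_one 0 hw
  have h1 := hasSum_choose_mul_geometric_of_norm_lt_one 1 hw
  have h2 := hasSum_choose_mul_geometric_of_norm_lt_one 2 hw
  have h := ((h0.mul_left ((α : ℂ) ^ 2 - α * (2 * β + 1) + β * (β + 1))).add
    (h1.mul_left (α * (2 * β + 1) - 3 * (α : ℂ) ^ 2))).add (h2.mul_left (2 * (α : ℂ) ^ 2))
  have hne : 1 - w ≠ 0 := by
    rw [sub_ne_zero]; rintro rfl; simp at hw
  convert! h using 1
  · funext k
    have : (((k + 2).choose 2 : ℕ) : ℂ) = (k + 2) * (k + 1) / 2 := by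
      rw [Nat.cast_choose_two]; push_cast; ring
    rw [this]
    simp only [Nat.choose_zero_right, Nat.choose_one_right]
    push_cast
    ring
  · unfold geomPoly
    field_simp
    ring

theorem norm_geomPoly_le {α β M : ℝ} (hα : 0 < α) (hβ : 0 < β) {p : ℂ} (hp : ‖p‖ ≤ M) :
    ‖geomPoly α β p‖ ≤
      ‖p‖ * (β * (β + 1) + α * (2 * β + 1) * (M + 1) + α ^ 2 * ((M + 1) * (2 * M + 1))) := by
  have h1 : ‖p - 1‖ ≤ M + 1 := (norm_sub_le _ _).trans (by simpa using hp)
  have h2 : ‖2 * p - 1‖ ≤ 2 * M + 1 := (norm_sub_le _ _).trans (by simpa using hp)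
  have hM : 0 ≤ M := (norm_nonneg p).trans hp
  have e1 : ‖(β : ℂ) * (β + 1)‖ = β * (β + 1) := by
    rw [← Complex.ofReal_one, ← Complex.ofReal_add, ← Complex.ofReal_mul, Complex.norm_real,
      Real.norm_of_nonneg (by positivity)]
  have e2 : ‖(α : ℂ) * (2 * β + 1)‖ = α * (2 * β + 1) := by
    have : (α : ℂ) * (2 * β + 1) = ((α * (2 * β + 1) : ℝ) : ℂ) := by push_cast; ring
    rw [this, Complex.norm_real, Real.norm_of_nonneg (by positivity)]
  have e3 : ‖(α : ℂ) ^ 2‖ = α ^ 2 := by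
    rw [norm_pow, Complex.norm_real, Real.norm_of_nonneg hα.le]
  rw [geomPoly, norm_mul]
  gcongr
  refine (norm_add₃_le).trans ?_
  rw [norm_mul _ (p - 1), norm_mul ((α : ℂ) ^ 2), norm_mul (p - 1), e1, e2, e3]
  gcongr

theorem cos_mul_norm_le_re_verticalLine_cpow {α : ℝ} (hα : 0 < α) (hα1 : α < 1) (ξ : ℝ) :
    Real.cos (Real.pi / 2 * α) * ‖verticalLine ξ ^ (α : ℂ)‖ ≤
      (verticalLine ξ ^ (α : ℂ)).re := by
  rw [Complex.cpow_ofReal_re, Complex.norm_cpow_real, mul_comm]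
  gcongr
  have harg : |Complex.arg (verticalLine ξ)| ≤ Real.pi / 2 :=
    Complex.abs_arg_le_pi_div_two_iff.2 (by simp [verticalLine_re])
  rw [← Real.cos_abs (Complex.arg _ * α), abs_mul, abs_of_pos hα]
  refine Real.cos_le_cos_of_nonneg_of_le_pi (by positivity) ?_ (by gcongr)
  nlinarith [Real.pi_pos]

theorem one_le_norm_verticalLine_cpow {α : ℝ} (hα : 0 < α) (ξ : ℝ) :
    1 ≤ ‖verticalLine ξ ^ (α : ℂ)‖ := by
  rw [Complex.norm_cpow_real]
  exact Real.one_le_rpow (one_le_norm_verticalLine ξ) hα.le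

/-- The integrand representing the Mittag-Leffler function. -/
noncomputable def mlIntegrand (α β : ℝ) (z : ℂ) (ξ : ℝ) : ℂ :=
  Complex.exp (verticalLine ξ) * verticalLine ξ ^ (-((β + 2 : ℝ) : ℂ)) *
    geomPoly α β (verticalLine ξ ^ (α : ℂ) / (verticalLine ξ ^ (α : ℂ) - z))

theorem norm_exp_mul_verticalLine_cpow (s ξ : ℝ) :
    ‖Complex.exp (verticalLine ξ) * verticalLine ξ ^ (-(s : ℂ))‖ =
      Real.exp 1 * ‖verticalLine ξ‖ ^ (-s) := by
  rw [norm_mul, Complex.norm_exp, verticalLine_re, ← Complex.ofReal_neg, Complex.norm_cpow_real]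

theorem integrable_exp_mul_verticalLine_cpow {s : ℝ} (hs : 1 < s) :
    Integrable fun ξ ↦ Complex.exp (verticalLine ξ) * verticalLine ξ ^ (-(s : ℂ)) := by
  refine ((integrable_norm_verticalLine_rpow hs).const_mul (Real.exp 1)).mono' ?_
    (Eventually.of_forall fun ξ ↦ (norm_exp_mul_verticalLine_cpow s ξ).le)
  exact ((Complex.continuous_exp.comp continuous_verticalLine).mul
    (continuous_verticalLine_cpow _)).aestronglyMeasurable

section Bounds

variable {α β δ : ℝ} {z : ℂ}

theorem half_mul_norm_le_norm_sub {v : ℂ} (hδ : 0 < δ) (hv : δ * ‖v‖ ≤ v.re) (hv1 : 1 ≤ ‖v‖)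
    (hz : z.re < δ / 2) : δ / 2 * ‖v‖ ≤ ‖v - z‖ := by
  have h := Complex.re_le_norm (v - z)
  rw [Complex.sub_re] at h
  nlinarith

theorem norm_div_sub_le {v : ℂ} (hδ : 0 < δ) (hv : δ * ‖v‖ ≤ v.re) (hv1 : 1 ≤ ‖v‖)
    (hz : z.re < δ / 2) : ‖v / (v - z)‖ ≤ 2 / δ := by
  have h := half_mul_norm_le_norm_sub hδ hv hv1 hz
  have hpos : 0 < ‖v - z‖ := lt_of_lt_of_le (by positivity) h
  rw [norm_div, div_le_div_iff₀ hpos hδ]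
  linarith

theorem norm_div_add_le {v : ℂ} {x : ℝ} (hδ : 0 < δ) (hδ1 : δ ≤ 1) (hx : 0 ≤ x)
    (hv : δ * ‖v‖ ≤ v.re) (hv1 : 1 ≤ ‖v‖) :
    ‖v / (v - (-x : ℝ))‖ ≤ ‖v‖ / (δ * (1 + x)) := by
  have h := Complex.re_le_norm (v - (-x : ℝ))
  rw [Complex.sub_re, Complex.ofReal_re] at h
  rw [norm_div]
  gcongr
  nlinarith

end Bounds

theorem exists_halfPlane_bounds {α : ℝ} (hα : 0 < α) (hα1 : α < 1) :
    ∃ δ : ℝ, 0 < δ ∧ δ ≤ 1 ∧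
      ∀ ξ, δ * ‖verticalLine ξ ^ (α : ℂ)‖ ≤ (verticalLine ξ ^ (α : ℂ)).re := by
  refine ⟨Real.cos (Real.pi / 2 * α), Real.cos_pos_of_mem_Ioo ⟨?_, ?_⟩, Real.cos_le_one _,
    cos_mul_norm_le_re_verticalLine_cpow hα hα1⟩ <;> nlinarith [Real.pi_pos]

theorem differentiableOn_integral_mlIntegrand {α β δ : ℝ} (hα : 0 < α) (hβ : 0 < β)
    (hδ : 0 < δ)
    (hre : ∀ ξ, δ * ‖verticalLine ξ ^ (α : ℂ)‖ ≤ (verticalLine ξ ^ (α : ℂ)).re) :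
    DifferentiableOn ℂ (fun z ↦ ∫ ξ, mlIntegrand α β z ξ) {z | z.re < δ / 2} := by
  have hne : ∀ (ξ : ℝ) (z : ℂ), z.re < δ / 2 → verticalLine ξ ^ (α : ℂ) - z ≠ 0 := by
    intro ξ z hz
    have h1 := one_le_norm_verticalLine_cpow hα ξ
    exact norm_pos_iff.1 <|
      lt_of_lt_of_le (by positivity) (half_mul_norm_le_norm_sub hδ (hre ξ) h1 hz)
  refine differentiableOn_integral_of_dominated
    (isOpen_lt Complex.continuous_re continuous_const)
    (bound := fun ξ ↦ ‖Complex.exp (verticalLine ξ) * verticalLine ξ ^ (-((β + 2 : ℝ) : ℂ))‖ *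
      (2 / δ * (β * (β + 1) + α * (2 * β + 1) * (2 / δ + 1) +
        α ^ 2 * ((2 / δ + 1) * (2 * (2 / δ) + 1))))) ?_ ?_ ?_ ?_
  · exact (integrable_exp_mul_verticalLine_cpow (by linarith)).norm.mul_const _
  · intro z hz
    refine Continuous.aestronglyMeasurable ?_
    have h1 : Continuous fun ξ ↦
        verticalLine ξ ^ (α : ℂ) / (verticalLine ξ ^ (α : ℂ) - z) :=
      (continuous_verticalLine_cpow _).div ((continuous_verticalLine_cpow _).sub continuous_const)
        fun ξ ↦ hne ξ z hz
    have h2 : Continuous (geomPoly α β) := by unfold geomPoly; fun_prop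
    exact ((Complex.continuous_exp.comp continuous_verticalLine).mul
      (continuous_verticalLine_cpow _)).mul (h2.comp h1)
  · refine Eventually.of_forall fun ξ z hz ↦ DifferentiableAt.differentiableWithinAt ?_
    have h1 : DifferentiableAt ℂ (fun z ↦
        verticalLine ξ ^ (α : ℂ) / (verticalLine ξ ^ (α : ℂ) - z)) z :=
      (differentiableAt_const _).div ((differentiableAt_const _).sub differentiableAt_id)
        (hne ξ z hz)
    have h2 : Differentiable ℂ (geomPoly α β) := by unfold geomPoly; fun_prop
    exact ((h2 _).comp z h1).const_mul _
  · refine Eventually.of_forall fun ξ z hz ↦ ?_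
    rw [mlIntegrand, norm_mul]
    have hp := norm_div_sub_le hδ (hre ξ) (one_le_norm_verticalLine_cpow hα ξ) hz
    refine mul_le_mul_of_nonneg_left ((norm_geomPoly_le hα hβ hp).trans ?_) (norm_nonneg _)
    gcongr

theorem tsum_eq_integral_mlIntegrand_of_norm_lt {α β : ℝ} (hα : 0 < α) (hβ : 0 < β) {z : ℂ}
    (hz : ‖z‖ < 1) :
    ∑' k : ℕ, z ^ k / ((Real.Gamma (α * k + β) : ℝ) : ℂ) = ∫ ξ, mlIntegrand α β z ξ := by
  set c : ℕ → ℂ := fun k ↦ ((α : ℂ) * k + β) * (α * k + β + 1) * z ^ k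
  set G : ℕ → ℝ → ℂ := fun k ξ ↦
    c k * (Complex.exp (verticalLine ξ) * verticalLine ξ ^ (-((α * k + β + 2 : ℝ) : ℂ)))
  have hint : ∀ k, ∫ ξ, G k ξ = z ^ k / ((Real.Gamma (α * k + β) : ℝ) : ℂ) := by
    intro k
    have hpos : 0 < α * k + β := by positivity
    have h0 : (α : ℂ) * k + β ≠ 0 := by exact_mod_cast hpos.ne'
    have h1 : (α : ℂ) * k + β + 1 ≠ 0 := by exact_mod_cast (by positivity : α * k + β + 1 ≠ 0)
    have hΓ : Real.Gamma (α * k + β + 2) =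
        (α * k + β + 1) * ((α * k + β) * Real.Gamma (α * k + β)) := by
      rw [← Real.Gamma_add_one hpos.ne', ← Real.Gamma_add_one (by positivity)]
      ring_nf
    simp only [G]
    rw [integral_const_mul, integral_exp_mul_verticalLine_cpow (by linarith),
      Complex.Gamma_ofReal, hΓ]
    have h2 : ((Real.Gamma (α * k + β) : ℝ) : ℂ) ≠ 0 := by
      exact_mod_cast (Real.Gamma_pos_of_pos hpos).ne'
    simp only [c]
    push_cast
    field_simp
  have hGi : ∀ k, Integrable (G k) := fun k ↦
    (integrable_exp_mul_verticalLine_cpow (by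
      have : 0 ≤ α * k := by positivity
      linarith)).const_mul _
  have hc : Summable fun k ↦ ‖c k‖ := (hasSum_geomPoly α β hz).summable.norm
  have hsum : Summable fun k ↦ ∫ ξ, ‖G k ξ‖ := by
    refine Summable.of_nonneg_of_le (fun k ↦ integral_nonneg fun ξ ↦ norm_nonneg _) (fun k ↦ ?_)
      (hc.mul_right (∫ ξ, Real.exp 1 * ‖verticalLine ξ‖ ^ (-(β + 2))))
    rw [← integral_const_mul]
    refine integral_mono (hGi k).norm
      (((integrable_norm_verticalLine_rpow (by linarith)).const_mul _).const_mul _) fun ξ ↦ ?_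
    simp only [G]
    rw [norm_mul, norm_exp_mul_verticalLine_cpow]
    have h1 := one_le_norm_verticalLine ξ
    have h2 : -(α * k + β + 2) ≤ -(β + 2) := by
      have : 0 ≤ α * k := by positivity
      linarith
    gcongr
  rw [← tsum_congr hint, (hasSum_integral_of_summable_integral_norm hGi hsum).tsum_eq]
  refine integral_congr_ae (Eventually.of_forall fun ξ ↦ ?_)
  have hu := verticalLine_ne_zero ξ
  have hv1 := one_le_norm_verticalLine_cpow hα ξ
  have hv : verticalLine ξ ^ (α : ℂ) ≠ 0 := norm_pos_iff.1 (by linarith)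
  have hw : ‖z / verticalLine ξ ^ (α : ℂ)‖ < 1 := by
    rw [norm_div, div_lt_one (by linarith)]; linarith
  have hvz : verticalLine ξ ^ (α : ℂ) - z ≠ 0 := by
    rw [sub_ne_zero]; rintro h; rw [h] at hv1; linarith
  have hS := (hasSum_geomPoly α β hw).mul_left
    (Complex.exp (verticalLine ξ) * verticalLine ξ ^ (-((β + 2 : ℝ) : ℂ)))
  have hp : 1 / (1 - z / verticalLine ξ ^ (α : ℂ)) =
      verticalLine ξ ^ (α : ℂ) / (verticalLine ξ ^ (α : ℂ) - z) := by
    field_simp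
  rw [hp] at hS
  simp only [mlIntegrand]
  rw [← hS.tsum_eq]
  refine tsum_congr fun k ↦ ?_
  have hpow : verticalLine ξ ^ (-((α * k + β + 2 : ℝ) : ℂ)) =
      verticalLine ξ ^ (-((β + 2 : ℝ) : ℂ)) / (verticalLine ξ ^ (α : ℂ)) ^ k := by
    rw [← Complex.cpow_mul_nat, ← Complex.cpow_sub _ _ hu]
    congr 1
    push_cast
    ring
  simp only [G, c]
  rw [hpow, div_pow]
  ring

theorem tsum_eq_integral_mlIntegrand {α β δ : ℝ} (hα : 0 < α) (hβ : 0 < β) (hδ : 0 < δ)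
    (hre : ∀ ξ, δ * ‖verticalLine ξ ^ (α : ℂ)‖ ≤ (verticalLine ξ ^ (α : ℂ)).re) {z : ℂ}
    (hz : z.re < δ / 2) :
    ∑' k : ℕ, z ^ k / ((Real.Gamma (α * k + β) : ℝ) : ℂ) = ∫ ξ, mlIntegrand α β z ξ := by
  have hU : IsOpen {z : ℂ | z.re < δ / 2} := isOpen_lt Complex.continuous_re continuous_const
  refine ((differentiable_tsum_pow_div_Gamma hα β).differentiableOn.analyticOnNhd
    hU).eqOn_of_preconnected_of_eventuallyEq
    ((differentiableOn_integral_mlIntegrand hα hβ hδ hre).analyticOnNhd hU)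
    (convex_halfSpace_re_lt (δ / 2)).isPreconnected (z₀ := 0) (by simpa using hδ) ?_ hz
  filter_upwards [Metric.ball_mem_nhds (0 : ℂ) one_pos] with w hw
  exact tsum_eq_integral_mlIntegrand_of_norm_lt hα hβ (by simpa using hw)

/-- For `0 < α < 1` and `β > 0` there is `C > 0` (depending only on `α, β`)
with `|E_{α,β}(−x)| ≤ C/(1+x)` for all `x ≥ 0`. -/
theorem mlE_decay_bound (α β : ℝ) (hα : 0 < α) (hα1 : α < 1) (hβ : 0 < β) :
    ∃ C : ℝ, 0 < C ∧ ∀ x : ℝ, 0 ≤ x → |mlE α β (-x)| ≤ C / (1 + x) := by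
  obtain ⟨δ, hδ, hδ1, hre⟩ := exists_halfPlane_bounds hα hα1
  set K := β * (β + 1) + α * (2 * β + 1) * (2 / δ + 1) +
    α ^ 2 * ((2 / δ + 1) * (2 * (2 / δ) + 1))
  have hK : 0 < K := by positivity
  set J := ∫ ξ, ‖verticalLine ξ‖ ^ (-(β + 2 - α))
  have hJ : 0 ≤ J := integral_nonneg fun ξ ↦ by positivity
  refine ⟨Real.exp 1 * K / δ * J + 1, by positivity, fun x hx ↦ ?_⟩
  have hz : (((-x : ℝ) : ℂ)).re < δ / 2 := by
    rw [Complex.ofReal_re]; linarith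
  have hE : ((mlE α β (-x) : ℝ) : ℂ) = ∫ ξ, mlIntegrand α β ((-x : ℝ) : ℂ) ξ := by
    rw [← tsum_eq_integral_mlIntegrand hα hβ hδ hre hz, mlE]
    push_cast
    rfl
  rw [← Real.norm_eq_abs, ← Complex.norm_real, hE]
  calc ‖∫ ξ, mlIntegrand α β ((-x : ℝ) : ℂ) ξ‖
      ≤ ∫ ξ, Real.exp 1 * K / δ / (1 + x) * ‖verticalLine ξ‖ ^ (-(β + 2 - α)) := by
        refine norm_integral_le_of_norm_le
          ((integrable_norm_verticalLine_rpow (by linarith)).const_mul _)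
          (Eventually.of_forall fun ξ ↦ ?_)
        have hv1 := one_le_norm_verticalLine_cpow hα ξ
        have hu : 0 < ‖verticalLine ξ‖ := by linarith [one_le_norm_verticalLine ξ]
        have hQ := norm_geomPoly_le hα hβ (norm_div_sub_le hδ (hre ξ) hv1 hz)
        have hp := norm_div_add_le hδ hδ1 hx (hre ξ) hv1
        rw [mlIntegrand, norm_mul, norm_exp_mul_verticalLine_cpow]
        calc _ ≤ Real.exp 1 * ‖verticalLine ξ‖ ^ (-(β + 2)) *
              (‖verticalLine ξ ^ (α : ℂ)‖ / (δ * (1 + x)) * K) := by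
              gcongr
              exact hQ.trans (mul_le_mul_of_nonneg_right hp hK.le)
          _ = _ := by
              rw [Complex.norm_cpow_real,
                show -(β + 2 - α) = -(β + 2) + α by ring, Real.rpow_add hu]
              field_simp
    _ = Real.exp 1 * K / δ * J / (1 + x) := by
        rw [integral_const_mul]; ring
    _ ≤ _ := by gcongr; linarith
end

section
/- (Exactness of the L1 scheme on piecewise linear functions.) Let 0 < α < 1, τ > 0, n ∈ ℕ, and set t_k = kτ. Let u : [0, t_{n+1}] → ℝ be continuous and affine on each subinterval [t_j, t_{j+1}] for j = 0,…,n. Then the Caputo derivative of u at t_{n+1} equals (D^α u)(t_{n+1}) = (τ^{−α} / Γ(2−α)) Σ_{j=0}^{n} (u(t_{j+1}) − u(t_j)) b_{n−j}, where b_k = (k+1)^{1−α} − k^{1−α}. -/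
open MeasureTheory Set

/-- The Caputo fractional derivative of order `α`. -/
noncomputable def caputo (α : ℝ) (u : ℝ → ℝ) (t : ℝ) : ℝ :=
  (1 / Real.Gamma (1 - α)) * ∫ s in (0:ℝ)..t, deriv u s * (t - s) ^ (-α)

/-- If `u` is affine on `[a, b]`, the integrand of the Caputo derivative is a constant multiple of
the kernel on `(a, b)`. -/
theorem deriv_mul_rpow_eqOn_of_affine {a b t r c : ℝ} {u : ℝ → ℝ}
    (hu : ∀ s ∈ Icc a b, u s = u a + (s - a) * c) :
    EqOn (fun s => deriv u s * (t - s) ^ r) (fun s => c * (t - s) ^ r) (Ioo a b) := by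
  intro s hs
  have hloc : u =ᶠ[nhds s] fun x => u a + (x - a) * c := by
    filter_upwards [Ioo_mem_nhds hs.1 hs.2] with x hx using hu x (Ioo_subset_Icc_self hx)
  have hd : HasDerivAt (fun x => u a + (x - a) * c) (1 * c) s :=
    (((hasDerivAt_id s).sub_const a).mul_const c).const_add (u a)
  simp only [hloc.deriv_eq, hd.deriv, one_mul]

theorem intervalIntegrable_deriv_mul_rpow_of_affine {a b t r c : ℝ} {u : ℝ → ℝ} (hab : a ≤ b)
    (hr : -1 < r) (hu : ∀ s ∈ Icc a b, u s = u a + (s - a) * c) :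
    IntervalIntegrable (fun s => deriv u s * (t - s) ^ r) volume a b := by
  have hk : IntervalIntegrable (fun s : ℝ => c * (t - s) ^ r) volume a b := by
    have h := (intervalIntegral.intervalIntegrable_rpow' (a := t - a) (b := t - b)
      hr).comp_sub_left t
    simp only [sub_sub_cancel] at h
    exact h.const_mul c
  refine hk.congr_uIoo ?_
  rw [uIoo_of_le hab]
  exact (deriv_mul_rpow_eqOn_of_affine hu).symm

theorem integral_deriv_mul_rpow_of_affine {a b t r c : ℝ} {u : ℝ → ℝ} (hab : a ≤ b)
    (hr : -1 < r) (hu : ∀ s ∈ Icc a b, u s = u a + (s - a) * c) :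
    ∫ s in a..b, deriv u s * (t - s) ^ r
      = c * (((t - a) ^ (r + 1) - (t - b) ^ (r + 1)) / (r + 1)) := by
  rw [intervalIntegral.integral_congr_Ioo_of_le hab (deriv_mul_rpow_eqOn_of_affine hu),
    intervalIntegral.integral_const_mul,
    intervalIntegral.integral_comp_sub_left (fun x : ℝ => x ^ r) t, integral_rpow (Or.inl hr)]

/-- Exactness of the L1 scheme on piecewise linear functions: if `u` is
continuous on `[0, t_{n+1}]` and affine on each `[t_j, t_{j+1}]` (`t_k = kτ`),
then `(D^α u)(t_{n+1}) = (τ^{−α}/Γ(2−α)) Σ_{j=0}^{n} (u(t_{j+1}) − u(t_j)) b_{n−j}`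
with `b_k = (k+1)^{1−α} − k^{1−α}`. -/
theorem L1_exact_on_piecewise_linear
    (α τ : ℝ) (hα : 0 < α) (hα1 : α < 1) (hτ : 0 < τ)
    (n : ℕ) (u : ℝ → ℝ)
    (haff : ∀ j : ℕ, j ≤ n → ∀ s ∈ Icc ((j : ℝ) * τ) (((j : ℝ) + 1) * τ),
      u s = u ((j : ℝ) * τ)
        + (s - (j : ℝ) * τ) / τ * (u (((j : ℝ) + 1) * τ) - u ((j : ℝ) * τ))) :
    caputo α u (((n : ℝ) + 1) * τ)
      = τ ^ (-α) / Real.Gamma (2 - α)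
          * ∑ j ∈ Finset.range (n + 1),
              (u (((j : ℝ) + 1) * τ) - u ((j : ℝ) * τ))
                * ((((n - j : ℕ) : ℝ) + 1) ^ (1 - α) - ((n - j : ℕ) : ℝ) ^ (1 - α)) := by
  have hr : -1 < -α := by linarith
  have hle (j : ℕ) : (j : ℝ) * τ ≤ ((j : ℝ) + 1) * τ := by gcongr; linarith
  have hslope (j : ℕ) (hj : j ≤ n) : ∀ s ∈ Icc ((j : ℝ) * τ) (((j : ℝ) + 1) * τ),
      u s = u ((j : ℝ) * τ)
        + (s - (j : ℝ) * τ) * ((u (((j : ℝ) + 1) * τ) - u ((j : ℝ) * τ)) / τ) := by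
    intro s hs
    rw [haff j hj s hs]
    ring
  have hsplit := intervalIntegral.sum_integral_adjacent_intervals (n := n + 1) (μ := volume)
    (a := fun k : ℕ => (k : ℝ) * τ)
    (f := fun s => deriv u s * (((n : ℝ) + 1) * τ - s) ^ (-α)) (by
      intro k hk
      push_cast
      exact intervalIntegrable_deriv_mul_rpow_of_affine (hle k) hr
        (hslope k (Nat.lt_succ_iff.mp hk)))
  push_cast at hsplit
  rw [zero_mul] at hsplit
  rw [caputo, ← hsplit, Finset.mul_sum, Finset.mul_sum]
  refine Finset.sum_congr rfl fun j hj => ?_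
  have hjn : j ≤ n := Nat.lt_succ_iff.mp (Finset.mem_range.mp hj)
  rw [integral_deriv_mul_rpow_of_affine (hle j) hr (hslope j hjn)]
  have hm : (0 : ℝ) ≤ ((n - j : ℕ) : ℝ) := Nat.cast_nonneg _
  have hleft : ((n : ℝ) + 1) * τ - (j : ℝ) * τ = (((n - j : ℕ) : ℝ) + 1) * τ := by
    rw [Nat.cast_sub hjn]; ring
  have hright : ((n : ℝ) + 1) * τ - ((j : ℝ) + 1) * τ = ((n - j : ℕ) : ℝ) * τ := by
    rw [Nat.cast_sub hjn]; ring
  have hexp : -α + 1 = 1 - α := by ring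
  have hα0 : 1 - α ≠ 0 := by linarith
  have hΓ : Real.Gamma (2 - α) = (1 - α) * Real.Gamma (1 - α) := by
    rw [← Real.Gamma_add_one hα0]; congr 1; ring
  have hΓ0 : Real.Gamma (1 - α) ≠ 0 := (Real.Gamma_pos_of_pos (by linarith)).ne'
  have hτα : τ ^ (1 - α) = τ ^ (-α) * τ := by
    rw [← hexp, Real.rpow_add_one hτ.ne']
  rw [hleft, hright, hexp, Real.mul_rpow (by positivity) hτ.le, Real.mul_rpow hm hτ.le, hΓ, hτα]
  field_simp
end

section
/- (Quadrature error of the exponential integrator.) Let 0 < α < 1, τ > 0, n ≥ 1 an integer, t_k = kτ, and L ≥ 0. Let g : [0, t_n] → ℝ satisfy |g(r) − g(r′)| ≤ L |r − r′|^α for all r, r′ ∈ [0, t_1], and |g(r) − g(r′)| ≤ L |r − r′| for all r, r′ ∈ [t_1, t_n]. Then there exist constants C₁, C₂ ≥ 0, depending only on α, L, and t_n, such that | Σ_{j=0}^{n−1} ∫_{t_j}^{t_{j+1}} (t_n − r)^{α−1} (g(r) − g(t_j)) dr | ≤ C₁ τ^{1+α} t_n^{α−1} + C₂ τ. -/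
open MeasureTheory Set

/-- The exact integral of the weakly singular kernel over an interval. -/
lemma integral_sub_left_rpow_sub_one {α : ℝ} (hα : 0 < α) (T a b : ℝ) :
    ∫ r in a..b, (T - r) ^ (α - 1) = ((T - a) ^ α - (T - b) ^ α) / α := by
  rw [intervalIntegral.integral_comp_sub_left (fun x : ℝ => x ^ (α - 1)),
    integral_rpow (Or.inl (by linarith)), sub_add_cancel]

lemma intervalIntegrable_sub_left_rpow_sub_one {α : ℝ} (hα : 0 < α) (T a b : ℝ) :
    IntervalIntegrable (fun r : ℝ => (T - r) ^ (α - 1)) volume a b := by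
  have h := (intervalIntegral.intervalIntegrable_rpow' (a := T - a) (b := T - b)
    (r := α - 1) (by linarith)).comp_sub_left T
  simpa using h

/-- A weighted integral against the weakly singular kernel is bounded by the supremum of the
other factor times the mass of the kernel. -/
lemma abs_integral_sub_left_rpow_mul_le {α T a b B : ℝ} (hα : 0 < α) (hab : a ≤ b)
    (hbT : b ≤ T) {f : ℝ → ℝ} (hf : ∀ r ∈ Icc a b, |f r| ≤ B) :
    |∫ r in a..b, (T - r) ^ (α - 1) * f r| ≤ B * (((T - a) ^ α - (T - b) ^ α) / α) := by
  rw [← integral_sub_left_rpow_sub_one hα, ← intervalIntegral.integral_const_mul,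
    ← Real.norm_eq_abs]
  refine intervalIntegral.norm_integral_le_of_norm_le hab (Filter.Eventually.of_forall ?_)
    ((intervalIntegrable_sub_left_rpow_sub_one hα T a b).const_mul B)
  intro r hr
  have hk : 0 ≤ (T - r) ^ (α - 1) := Real.rpow_nonneg (by linarith [hr.2]) _
  rw [Real.norm_eq_abs, abs_mul, abs_of_nonneg hk, mul_comm]
  exact mul_le_mul_of_nonneg_right (hf r (Ioc_subset_Icc_self hr)) hk

lemma rpow_sub_rpow_sub_le {α T τ : ℝ} (hα1 : α ≤ 1) (hτ : 0 ≤ τ) (hτT : τ ≤ T)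
    (hT : 0 < T) : T ^ α - (T - τ) ^ α ≤ τ * T ^ (α - 1) := by
  have hx0 : 0 ≤ 1 - τ / T := sub_nonneg.2 ((div_le_one hT).2 hτT)
  have hx1 : 1 - τ / T ≤ 1 := sub_le_self _ (by positivity)
  have h := Real.self_le_rpow_of_le_one hx0 hx1 hα1
  have hsplit : T - τ = T * (1 - τ / T) := by field_simp
  rw [hsplit, Real.mul_rpow hT.le hx0, Real.rpow_sub_one hT.ne']
  have h' := mul_le_mul_of_nonneg_left h (Real.rpow_nonneg hT.le α)
  calc T ^ α - T ^ α * (1 - τ / T) ^ α ≤ T ^ α - T ^ α * (1 - τ / T) := by linarith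
    _ = τ * (T ^ α / T) := by ring

/-- Quadrature error of the exponential integrator: if `g` is `α`-Hölder
on `[0, t_1]` and Lipschitz on `[t_1, t_n]` with constant `L`, then
`|Σ_{j<n} ∫_{t_j}^{t_{j+1}} (t_n−r)^{α−1}(g(r)−g(t_j)) dr|
  ≤ C₁ τ^{1+α} t_n^{α−1} + C₂ τ`, where `C₁, C₂ ≥ 0` depend only on
`α`, `L` and `t_n = T`. -/
theorem ei_quadrature_error
    (α L T : ℝ) (hα : 0 < α) (hα1 : α < 1) (hL : 0 ≤ L) (hT : 0 < T) :
    ∃ C₁ : ℝ, 0 ≤ C₁ ∧ ∃ C₂ : ℝ, 0 ≤ C₂ ∧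
      ∀ τ : ℝ, 0 < τ → ∀ n : ℕ, 1 ≤ n → (n : ℝ) * τ = T →
      ∀ g : ℝ → ℝ,
      (∀ r ∈ Icc (0:ℝ) τ, ∀ r' ∈ Icc (0:ℝ) τ, |g r - g r'| ≤ L * |r - r'| ^ α) →
      (∀ r ∈ Icc τ T, ∀ r' ∈ Icc τ T, |g r - g r'| ≤ L * |r - r'|) →
      |∑ j ∈ Finset.range n,
          ∫ r in ((j : ℝ) * τ)..(((j : ℝ) + 1) * τ),
            (T - r) ^ (α - 1) * (g r - g ((j : ℝ) * τ))|
        ≤ C₁ * τ ^ (1 + α) * T ^ (α - 1) + C₂ * τ := by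
  refine ⟨L / α, by positivity, L * T ^ α / α, by positivity, ?_⟩
  intro τ hτ n hn hnT g hg₀ hg₁
  obtain ⟨m, rfl⟩ : ∃ m, n = m + 1 := ⟨n - 1, by omega⟩
  push_cast at hnT
  have hτT : τ ≤ T := by nlinarith [mul_nonneg (Nat.cast_nonneg (α := ℝ) m) hτ.le]
  rw [Finset.sum_range_succ']
  have hfirst : |∫ r in (((0 : ℕ) : ℝ) * τ)..((((0 : ℕ) : ℝ) + 1) * τ),
      (T - r) ^ (α - 1) * (g r - g (((0 : ℕ) : ℝ) * τ))|
        ≤ L / α * τ ^ (1 + α) * T ^ (α - 1) := by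
    simp only [Nat.cast_zero, zero_mul, zero_add, one_mul]
    refine (abs_integral_sub_left_rpow_mul_le (B := L * τ ^ α) hα hτ.le hτT ?_).trans ?_
    · intro r hr
      refine (hg₀ r hr 0 ⟨le_rfl, hτ.le⟩).trans ?_
      rw [sub_zero, abs_of_nonneg hr.1]
      exact mul_le_mul_of_nonneg_left (Real.rpow_le_rpow hr.1 hr.2 hα.le) hL
    · rw [sub_zero, Real.rpow_add hτ, Real.rpow_one]
      calc L * τ ^ α * ((T ^ α - (T - τ) ^ α) / α)
          ≤ L * τ ^ α * (τ * T ^ (α - 1) / α) := by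
            gcongr
            exact rpow_sub_rpow_sub_le hα1.le hτ.le hτT hT
        _ = L / α * (τ * τ ^ α) * T ^ (α - 1) := by ring
  have hrest : |∑ j ∈ Finset.range m,
      ∫ r in (((j + 1 : ℕ) : ℝ) * τ)..((((j + 1 : ℕ) : ℝ) + 1) * τ),
        (T - r) ^ (α - 1) * (g r - g (((j + 1 : ℕ) : ℝ) * τ))| ≤ L * T ^ α / α * τ := by
    let u : ℕ → ℝ := fun j => (T - ((j : ℝ) + 1) * τ) ^ α
    calc _ ≤ ∑ j ∈ Finset.range m, L * τ / α * (u j - u (j + 1)) := by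
          refine (Finset.abs_sum_le_sum_abs _ _).trans (Finset.sum_le_sum fun j hj => ?_)
          have hjm : (j : ℝ) + 1 ≤ m := by exact_mod_cast Finset.mem_range.1 hj
          have hj0 : (0 : ℝ) ≤ j := j.cast_nonneg
          have hτj : τ ≤ ((j : ℝ) + 1) * τ := by nlinarith
          have hjT : ((j : ℝ) + 1 + 1) * τ ≤ T := by
            rw [← hnT]
            gcongr
          have hlen : ((j : ℝ) + 1) * τ + τ = ((j : ℝ) + 1 + 1) * τ := by ring
          push_cast
          refine (abs_integral_sub_left_rpow_mul_le (B := L * τ) hα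
            (by linarith) hjT ?_).trans_eq ?_
          · intro r hr
            refine (hg₁ r ⟨hτj.trans hr.1, hr.2.trans hjT⟩ _ ⟨hτj, by linarith⟩).trans ?_
            rw [abs_of_nonneg (sub_nonneg.2 hr.1)]
            exact mul_le_mul_of_nonneg_left (by linarith [hr.2]) hL
          · simp only [u]
            push_cast
            ring
      _ = L * τ / α * (u 0 - u m) := by
          rw [← Finset.mul_sum, Finset.sum_range_sub']
      _ ≤ L * τ / α * T ^ α := by
          gcongr
          have hm : u m = 0 := by simp [u, hnT, hα.ne']
          rw [hm, sub_zero]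
          simp only [u, Nat.cast_zero, zero_add, one_mul]
          exact Real.rpow_le_rpow (by linarith) (by linarith) hα.le
      _ = L * T ^ α / α * τ := by ring
  exact (abs_add_le _ _).trans (by linarith)
end
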